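/- arXiv:2404.09603 — 4 statements merged into one kernel-verified Lean document; each statement's English description precedes it below -/
import Mathlib

section
/- There exist δ ∈ (0,1) and C > 0 such that for every odd u ∈ 𝒮(ℝ;ℂ), setting ψ(x) := ⟨x⟩ − δ·log⟨x⟩ and Λ_ψ u := ψ'·∂ₓu + (ψ''/2)·u, one has ∫_ℝ ( ⟨x⟩⁻²·|∂ₓu(x)|² + ⟨x⟩⁻⁴·|u(x)|² ) dx ≤ C · Re ∫_ℝ (−∂ₓₓu)(x) · conj(Λ_ψ u)(x) dx. -/
/-- The truncated Morawetz weight `ψ(x) = ⟨x⟩ − δ log⟨x⟩` on `ℝ`. -/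
noncomputable def psiW (δ : ℝ) (x : ℝ) : ℝ :=
  Real.sqrt (1 + x ^ 2) - δ * Real.log (Real.sqrt (1 + x ^ 2))

/-- `Λ_ψ u = ψ'·∂ₓu + (ψ''/2)·u`. -/
noncomputable def LamPsi (δ : ℝ) (u : ℝ → ℂ) (x : ℝ) : ℂ :=
  ((deriv (psiW δ) x : ℝ) : ℂ) * deriv u x + ((deriv (deriv (psiW δ)) x / 2 : ℝ) : ℂ) * u x

open scoped BoundedContinuousFunction

/-- The reciprocal Japanese bracket `⟨x⟩⁻¹`. -/
noncomputable def invBracket (x : ℝ) : ℝ := (Real.sqrt (1 + x ^ 2))⁻¹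

lemma invBracket_pos (x : ℝ) : 0 < invBracket x := by unfold invBracket; positivity

lemma invBracket_sq (x : ℝ) : invBracket x ^ 2 = (1 + x ^ 2)⁻¹ := by
  rw [invBracket, inv_pow, Real.sq_sqrt (by positivity)]

lemma sq_mul_invBracket_sq (x : ℝ) : x ^ 2 * invBracket x ^ 2 = 1 - invBracket x ^ 2 := by
  rw [invBracket_sq]; field_simp; ring

lemma invBracket_le_one (x : ℝ) : invBracket x ≤ 1 := by
  nlinarith [sq_mul_invBracket_sq x, mul_nonneg (sq_nonneg x) (sq_nonneg (invBracket x)),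
    invBracket_pos x]

lemma hasDerivAt_sqrt_one_add_sq (x : ℝ) :
    HasDerivAt (fun y : ℝ => Real.sqrt (1 + y ^ 2)) (x * invBracket x) x := by
  have h := (((hasDerivAt_id x).pow 2).const_add 1).sqrt (by simp; positivity)
  refine h.congr_deriv ?_
  have : Real.sqrt (1 + x ^ 2) ≠ 0 := by positivity
  simp [invBracket]
  field_simp

lemma hasDerivAt_invBracket (x : ℝ) :
    HasDerivAt invBracket (-(x * invBracket x ^ 3)) x := by
  have h := (hasDerivAt_sqrt_one_add_sq x).inv (by positivity)
  refine h.congr_deriv ?_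
  simp only [invBracket]
  field_simp

lemma continuous_invBracket : Continuous invBracket :=
  continuous_iff_continuousAt.2 fun x => (hasDerivAt_invBracket x).continuousAt

lemma hasDerivAt_psiW (δ x : ℝ) :
    HasDerivAt (psiW δ) (x * invBracket x - δ * (x * invBracket x ^ 2)) x := by
  have h0 := hasDerivAt_sqrt_one_add_sq x
  refine (h0.sub ((h0.log (by positivity)).const_mul δ)).congr_deriv ?_
  simp only [invBracket]
  field_simp

lemma deriv_psiW (δ : ℝ) :
    deriv (psiW δ) = fun x => x * invBracket x - δ * (x * invBracket x ^ 2) :=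
  funext fun x => (hasDerivAt_psiW δ x).deriv

lemma deriv_deriv_psiW (δ x : ℝ) :
    deriv (deriv (psiW δ)) x =
      invBracket x ^ 3 + δ * (invBracket x ^ 2 - 2 * invBracket x ^ 4) := by
  rw [deriv_psiW]
  have hx := hasDerivAt_id' x
  have ht := hasDerivAt_invBracket x
  refine ((hx.mul ht).sub ((hx.mul (ht.pow 2)).const_mul δ)).deriv.trans ?_
  simp only [Pi.pow_apply]
  norm_num
  linear_combination (-invBracket x + 2 * δ * invBracket x ^ 2) * sq_mul_invBracket_sq x

lemma integrable_invBracket_sq_mul (b : ℝ →ᵇ ℝ) :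
    MeasureTheory.Integrable fun x => invBracket x ^ 2 * b x := by
  simp only [invBracket_sq]
  exact integrable_inv_one_add_sq.mul_bdd (c := ‖b‖) b.continuous.aestronglyMeasurable
    (Filter.Eventually.of_forall fun x => b.norm_coe_le_norm x)

/-- `⟨x⟩⁻¹` as a bounded continuous function. -/
noncomputable def invBracketBCF : ℝ →ᵇ ℝ :=
  BoundedContinuousFunction.ofNormedAddCommGroup invBracket continuous_invBracket 1 fun x => by
    rw [Real.norm_of_nonneg (invBracket_pos x).le]; exact invBracket_le_one x

/-- `x⟨x⟩⁻¹` as a bounded continuous function. -/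
noncomputable def mulInvBracketBCF : ℝ →ᵇ ℝ :=
  BoundedContinuousFunction.ofNormedAddCommGroup (fun x => x * invBracket x)
    (continuous_id.mul continuous_invBracket) 1 fun x => by
      rw [Real.norm_eq_abs, abs_le_one_iff_mul_self_le_one]
      nlinarith [sq_mul_invBracket_sq x, sq_nonneg (invBracket x)]

@[simp] lemma invBracketBCF_apply (x : ℝ) : invBracketBCF x = invBracket x := rfl

@[simp] lemma mulInvBracketBCF_apply (x : ℝ) : mulInvBracketBCF x = x * invBracket x := rfl

/-- Derivative of the boundary term of the Hardy-type substitution by `x`. -/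
lemma hasDerivAt_mul_quotient {a p d : ℝ → ℝ} {a' p' x : ℝ} (ha : HasDerivAt a a' x)
    (hp : HasDerivAt p p' x) (hd : Continuous d) (hpd : ∀ y, p y = y * d y)
    (hd0 : x = 0 → d 0 = p') :
    HasDerivAt (fun y => a y * p y * d y)
      (a' * p x * d x + 2 * (a x * p' * d x) - a x * d x ^ 2) x := by
  rcases eq_or_ne x 0 with rfl | hx
  · have h : HasDerivAt (fun y => p y * d y) (p' * d 0) 0 := by
      rw [hasDerivAt_iff_tendsto_slope] at hp ⊢
      refine (hp.mul ((hd.tendsto 0).mono_left nhdsWithin_le_nhds)).congr fun y => ?_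
      simp [slope_def_field, hpd 0]
      ring
    have h2 := ha.mul h
    simp only [← mul_assoc] at h2
    refine (h2.congr_of_eventuallyEq (Filter.Eventually.of_forall fun y => ?_)).congr_deriv ?_
    · simp [mul_assoc]
    · rw [hd0 rfl]; ring
  · have h : HasDerivAt d ((p' - d x) / x) x := by
      have h1 := hp.div (hasDerivAt_id' x) hx
      refine (h1.congr_of_eventuallyEq ?_).congr_deriv ?_
      · filter_upwards [isOpen_ne.mem_nhds hx] with y hy
        have hy : y ≠ 0 := hy
        simp [hpd, hy]
      · rw [hpd]; field_simp
    refine ((ha.mul hp).mul h).congr_deriv ?_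
    simp only [Pi.mul_apply, hpd x]
    field_simp
    ring

lemma morawetz_pointwise {t : ℝ} (ht : 0 < t) (ht1 : t ≤ 1) (p p' d : ℝ) :
    (t ^ 2 * p' ^ 2 + t ^ 4 * p ^ 2) / 224 ≤
      1 / 56 * ((t ^ 3 + 1 / 4 * (t ^ 2 - 2 * t ^ 4)) * p' ^ 2
        + (-3 * t ^ 5 + 15 / 4 * t ^ 7 - 3 / 8 * t ^ 4 + 3 * t ^ 6 - 3 * t ^ 8) * p ^ 2)
      + 55 / 56 * ((15 / 4 * t ^ 7 + 1 / 8 * t ^ 4 + t ^ 6 - 3 * t ^ 8) * p ^ 2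
        + (t ^ 3 + 1 / 4 * (t ^ 2 - 2 * t ^ 4)) * (p' - d) ^ 2) := by
  have e (k : ℕ) : t ^ (k + 1) ≤ t ^ k := pow_le_pow_of_le_one ht.le ht1 k.le_succ
  have e2 : t ^ 3 ≤ t ^ 2 := e 2
  have e3 : t ^ 4 ≤ t ^ 3 := e 3
  have e5 : t ^ 6 ≤ t ^ 5 := e 5
  have e4 : t ^ 5 ≤ t ^ 4 := e 4
  have e6 : t ^ 7 ≤ t ^ 6 := e 6
  have e7 : t ^ 8 ≤ t ^ 7 := e 7
  have h3 : 0 < t ^ 3 := by positivity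
  have h4 : 0 < t ^ 4 := by positivity
  have h6 : 0 < t ^ 6 := by positivity
  have h7 : 0 < t ^ 7 := by positivity
  have a1 : 1 / 4 * t ^ 2 ≤ t ^ 3 + 1 / 4 * (t ^ 2 - 2 * t ^ 4) := by linarith
  have a2 : 1 / 8 * t ^ 4 ≤ 15 / 4 * t ^ 7 + 1 / 8 * t ^ 4 + t ^ 6 - 3 * t ^ 8 := by linarith
  have a3 : -27 / 8 * t ^ 4 ≤
      -3 * t ^ 5 + 15 / 4 * t ^ 7 - 3 / 8 * t ^ 4 + 3 * t ^ 6 - 3 * t ^ 8 := by linarith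
  have b1 := mul_le_mul_of_nonneg_right a1 (sq_nonneg p')
  have b2 := mul_le_mul_of_nonneg_right a2 (sq_nonneg p)
  have b3 := mul_le_mul_of_nonneg_right a3 (sq_nonneg p)
  have b4 : 0 ≤ (t ^ 3 + 1 / 4 * (t ^ 2 - 2 * t ^ 4)) * (p' - d) ^ 2 :=
    mul_nonneg (by nlinarith) (sq_nonneg _)
  have b5 : 0 ≤ t ^ 4 * p ^ 2 := by positivity
  linarith

/-- The real-valued Morawetz estimate with `δ = 1/4`; `d` plays the role of `p / x`. -/
lemma morawetz_real {p p' p'' : ℝ → ℝ} (P P' P'' d : ℝ →ᵇ ℝ)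
    (hP : ∀ x, p x = invBracket x ^ 2 * P x) (hP' : ∀ x, p' x = invBracket x ^ 2 * P' x)
    (hP'' : ∀ x, p'' x = invBracket x ^ 2 * P'' x) (hp : ∀ x, HasDerivAt p (p' x) x)
    (hp' : ∀ x, HasDerivAt p' (p'' x) x) (hpd : ∀ x, p x = x * d x) (hd0 : d 0 = p' 0) :
    MeasureTheory.Integrable
        (fun x => invBracket x ^ 2 * p' x ^ 2 + invBracket x ^ 4 * p x ^ 2) ∧
      MeasureTheory.Integrable (fun x => -p'' x * (deriv (psiW (1 / 4)) x * p' x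
        + deriv (deriv (psiW (1 / 4))) x / 2 * p x)) ∧
      ∫ x, (invBracket x ^ 2 * p' x ^ 2 + invBracket x ^ 4 * p x ^ 2) ≤
        224 * ∫ x, -p'' x * (deriv (psiW (1 / 4)) x * p' x
          + deriv (deriv (psiW (1 / 4))) x / 2 * p x) := by
  simp only [deriv_deriv_psiW]
  simp only [deriv_psiW]
  set T := invBracketBCF with hT
  set X := mulInvBracketBCF with hX
  set A : ℝ →ᵇ ℝ := T ^ 3 + (1 / 4 : ℝ) • (T ^ 2 - (2 : ℝ) • T ^ 4) with hA
  have iE : MeasureTheory.Integrable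
      (fun x => invBracket x ^ 2 * p' x ^ 2 + invBracket x ^ 4 * p x ^ 2) := by
    refine (integrable_invBracket_sq_mul (T ^ 4 * P' ^ 2 + T ^ 6 * P ^ 2)).congr
      (Filter.Eventually.of_forall fun x => ?_)
    simp [hT, hP, hP']
    ring
  have iN : MeasureTheory.Integrable (fun x => -p'' x *
      ((x * invBracket x - 1 / 4 * (x * invBracket x ^ 2)) * p' x
        + (invBracket x ^ 3 + 1 / 4 * (invBracket x ^ 2 - 2 * invBracket x ^ 4)) / 2 * p x)) := by
    refine (integrable_invBracket_sq_mul (-P'' * (T ^ 2 * (X - (1 / 4 : ℝ) • (X * T)) * P'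
      + T ^ 2 * (1 / 2 : ℝ) • A * P))).congr (Filter.Eventually.of_forall fun x => ?_)
    simp [hT, hX, hA, hP, hP', hP'']
    ring
  refine ⟨iE, iN, ?_⟩
  let H : ℝ → ℝ := fun x =>
    (-(1 / 2) * (x * invBracket x - 1 / 4 * (x * invBracket x ^ 2)) * p' x ^ 2
      - 1 / 2 * (invBracket x ^ 3 + 1 / 4 * (invBracket x ^ 2 - 2 * invBracket x ^ 4))
        * (p' x * p x)
      + 1 / 4 * (-(x * invBracket x ^ 3) *
        (3 * invBracket x ^ 2 + 1 / 2 * invBracket x - 2 * invBracket x ^ 3)) * p x ^ 2)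
    + 55 / 56 * ((invBracket x ^ 3 + 1 / 4 * (invBracket x ^ 2 - 2 * invBracket x ^ 4))
        * p x * d x)
  let R : ℝ → ℝ := fun x =>
      1 / 56 * ((invBracket x ^ 3 + 1 / 4 * (invBracket x ^ 2 - 2 * invBracket x ^ 4)) * p' x ^ 2
        + (-3 * invBracket x ^ 5 + 15 / 4 * invBracket x ^ 7 - 3 / 8 * invBracket x ^ 4
          + 3 * invBracket x ^ 6 - 3 * invBracket x ^ 8) * p x ^ 2)
      + 55 / 56 * ((15 / 4 * invBracket x ^ 7 + 1 / 8 * invBracket x ^ 4 + invBracket x ^ 6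
          - 3 * invBracket x ^ 8) * p x ^ 2
        + (invBracket x ^ 3 + 1 / 4 * (invBracket x ^ 2 - 2 * invBracket x ^ 4))
          * (p' x - d x) ^ 2)
  have iH : MeasureTheory.Integrable H := by
    refine (integrable_invBracket_sq_mul
      (-(1 / 2 : ℝ) • (X - (1 / 4 : ℝ) • (X * T)) * T ^ 2 * P' ^ 2
        - (1 / 2 : ℝ) • A * T ^ 2 * (P' * P)
        + (1 / 4 : ℝ) • (-(X * T ^ 2) * ((3 : ℝ) • T ^ 2 + (1 / 2 : ℝ) • T - (2 : ℝ) • T ^ 3))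
          * T ^ 2 * P ^ 2
        + (55 / 56 : ℝ) • (A * P * d))).congr (Filter.Eventually.of_forall fun x => ?_)
    simp [H, hT, hX, hA, hP, hP']
    ring
  have iR : MeasureTheory.Integrable R := by
    refine (integrable_invBracket_sq_mul
      ((1 / 56 : ℝ) • (A * T ^ 2 * P' ^ 2
        + (-(3 : ℝ) • T ^ 5 + (15 / 4 : ℝ) • T ^ 7 - (3 / 8 : ℝ) • T ^ 4
          + (3 : ℝ) • T ^ 6 - (3 : ℝ) • T ^ 8) * T ^ 2 * P ^ 2)
      + (55 / 56 : ℝ) • (((15 / 4 : ℝ) • T ^ 7 + (1 / 8 : ℝ) • T ^ 4 + T ^ 6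
          - (3 : ℝ) • T ^ 8) * T ^ 2 * P ^ 2
        + (T + (1 / 4 : ℝ) • (1 - (2 : ℝ) • T ^ 2)) * (T ^ 2 * P' - d) ^ 2))).congr
      (Filter.Eventually.of_forall fun x => ?_)
    simp [R, hT, hA, hP, hP']
    ring
  have hH (x : ℝ) : HasDerivAt H (-p'' x *
      ((x * invBracket x - 1 / 4 * (x * invBracket x ^ 2)) * p' x
        + (invBracket x ^ 3 + 1 / 4 * (invBracket x ^ 2 - 2 * invBracket x ^ 4)) / 2 * p x)
        - R x) x := by
    have hx := hasDerivAt_id' x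
    have ht := hasDerivAt_invBracket x
    have ha := (ht.pow 3).add (((ht.pow 2).sub ((ht.pow 4).const_mul 2)).const_mul (1 / 4))
    have hF := hasDerivAt_mul_quotient ha (hp x) d.continuous hpd (by rintro rfl; exact hd0)
    have hG1 := ((hx.mul ht).sub ((hx.mul (ht.pow 2)).const_mul (1 / 4))).const_mul (-(1 / 2))
      |>.mul ((hp' x).pow 2)
    have hG2 := (ha.const_mul (1 / 2)).mul ((hp' x).mul (hp x))
    have hG3 := (((hx.mul (ht.pow 3)).neg.mul ((((ht.pow 2).const_mul 3).add
      (ht.const_mul (1 / 2))).sub ((ht.pow 3).const_mul 2))).const_mul (1 / 4)).mul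
        ((hp x).pow 2)
    refine (((hG1.sub hG2).add hG3).add (hF.const_mul (55 / 56))).congr_deriv ?_
    simp only [R, Pi.pow_apply, Pi.add_apply, Pi.sub_apply, Pi.mul_apply, Pi.neg_apply]
    have h := sq_mul_invBracket_sq x
    have hq := hpd x
    generalize invBracket x = t at *
    generalize p x = q at *
    generalize d x = e at *
    subst hq
    push_cast
    linear_combination ((1 / 2 * t - 1 / 4 * t ^ 2) * p' x ^ 2
      + 1 / 4 * (15 * t ^ 5 + 2 * t ^ 4 - 12 * t ^ 6) * (x * e) ^ 2) * h
  have h0 := MeasureTheory.integral_eq_zero_of_hasDerivAt_of_integrable hH (iN.sub iR) iH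
  rw [MeasureTheory.integral_sub iN iR, sub_eq_zero] at h0
  rw [h0, ← MeasureTheory.integral_const_mul]
  refine MeasureTheory.integral_mono iE (iR.const_mul 224) fun x => ?_
  have := morawetz_pointwise (invBracket_pos x) (invBracket_le_one x) (p x) (p' x) (d x)
  simp only [R]
  linarith


/-- A continuous function with `(1 + x²) f` bounded is `⟨x⟩⁻²` times a bounded continuous one. -/
lemma exists_bcf_eq_invBracket_sq_mul {f : ℝ → ℝ} (hf : Continuous f) {C : ℝ}
    (hC : ∀ x, (1 + x ^ 2) * |f x| ≤ C) : ∃ F : ℝ →ᵇ ℝ, ∀ x, f x = invBracket x ^ 2 * F x := by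
  refine ⟨BoundedContinuousFunction.ofNormedAddCommGroup (fun x => (1 + x ^ 2) * f x)
    (by fun_prop) C fun x => ?_, fun x => ?_⟩
  · rw [norm_mul, Real.norm_of_nonneg (by positivity)]
    exact hC x
  · simp only [BoundedContinuousFunction.coe_ofNormedAddCommGroup, invBracket_sq]
    field_simp

lemma SchwartzMap.exists_one_add_sq_mul_norm_le (u : SchwartzMap ℝ ℂ) :
    ∃ C, ∀ x : ℝ, (1 + x ^ 2) * ‖u x‖ ≤ C := by
  refine ⟨SchwartzMap.seminorm ℝ 0 0 u + SchwartzMap.seminorm ℝ 2 0 u, fun x => ?_⟩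
  have h0 := u.norm_le_seminorm ℝ x
  have h2 := u.norm_pow_mul_le_seminorm ℝ 2 x
  rw [Real.norm_eq_abs, sq_abs] at h2
  linarith

/-- The quotient of a `C¹` function vanishing at `0`, with bounded derivative, by `x`. -/
lemma exists_bcf_eq_mul {p p' : ℝ → ℝ} (hp : ∀ x, HasDerivAt p (p' x) x) (h0 : p 0 = 0) {C : ℝ}
    (hC : ∀ x, |p' x| ≤ C) : ∃ d : ℝ →ᵇ ℝ, (∀ x, p x = x * d x) ∧ d 0 = p' 0 := by
  have hmul (x : ℝ) : x * dslope p 0 x = p x := by simpa [h0] using sub_smul_dslope p 0 x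
  have hzero : dslope p 0 0 = p' 0 := by rw [dslope_same, (hp 0).deriv]
  have hc : Continuous (dslope p 0) := by
    rw [← continuousOn_univ, continuousOn_dslope Filter.univ_mem]
    exact ⟨fun x _ => (hp x).continuousAt.continuousWithinAt, (hp 0).differentiableAt⟩
  refine ⟨BoundedContinuousFunction.ofNormedAddCommGroup (dslope p 0) hc C fun x => ?_,
    fun x => (hmul x).symm, hzero⟩
  rcases eq_or_ne x 0 with rfl | hx
  · rw [hzero]; exact hC 0
  · have h := convex_univ.norm_image_sub_le_of_norm_hasDerivWithin_le (f := p)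
      (fun y _ => (hp y).hasDerivWithinAt) (fun y _ => hC y) (Set.mem_univ 0) (Set.mem_univ x)
    rw [h0, sub_zero, sub_zero, ← hmul x, norm_mul, mul_comm] at h
    exact le_of_mul_le_mul_right h (norm_pos_iff.2 hx)

/-- The Morawetz estimate for the image of a Schwartz function vanishing at `0` under a
real-linear functional of norm at most one. -/
lemma morawetz_comp (L : ℂ →L[ℝ] ℝ) (hL : ∀ z, |L z| ≤ ‖z‖) (u : SchwartzMap ℝ ℂ)
    (h0 : u 0 = 0) :
    MeasureTheory.Integrable (fun x => invBracket x ^ 2 * L (deriv u x) ^ 2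
        + invBracket x ^ 4 * L (u x) ^ 2) ∧
      MeasureTheory.Integrable (fun x => -L (deriv (deriv u) x) *
        (deriv (psiW (1 / 4)) x * L (deriv u x)
          + deriv (deriv (psiW (1 / 4))) x / 2 * L (u x))) ∧
      ∫ x, (invBracket x ^ 2 * L (deriv u x) ^ 2 + invBracket x ^ 4 * L (u x) ^ 2) ≤
        224 * ∫ x, -L (deriv (deriv u) x) * (deriv (psiW (1 / 4)) x * L (deriv u x)
          + deriv (deriv (psiW (1 / 4))) x / 2 * L (u x)) := by
  set u' := SchwartzMap.derivCLM ℝ ℂ u with hu'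
  set u'' := SchwartzMap.derivCLM ℝ ℂ u' with hu''
  have e' : deriv u = u' := rfl
  have e'' : deriv u' = u'' := rfl
  have bound (v : SchwartzMap ℝ ℂ) : ∃ C, ∀ x : ℝ, (1 + x ^ 2) * |L (v x)| ≤ C := by
    obtain ⟨C, hC⟩ := v.exists_one_add_sq_mul_norm_le
    exact ⟨C, fun x => (mul_le_mul_of_nonneg_left (hL _) (by positivity)).trans (hC x)⟩
  have hd (v : SchwartzMap ℝ ℂ) (x : ℝ) : HasDerivAt (fun y => L (v y)) (L (deriv v x)) x :=
    L.hasFDerivAt.comp_hasDerivAt x (v.hasDerivAt x)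
  obtain ⟨C, hC⟩ := bound u
  obtain ⟨C', hC'⟩ := bound u'
  obtain ⟨C'', hC''⟩ := bound u''
  obtain ⟨P, hP⟩ := exists_bcf_eq_invBracket_sq_mul (L.continuous.comp u.continuous) hC
  obtain ⟨P', hP'⟩ := exists_bcf_eq_invBracket_sq_mul (L.continuous.comp u'.continuous) hC'
  obtain ⟨P'', hP''⟩ := exists_bcf_eq_invBracket_sq_mul (L.continuous.comp u''.continuous) hC''
  obtain ⟨d, hmul, hzero⟩ := exists_bcf_eq_mul (hd u) (by simp [h0]) (C := C') fun x =>
    le_trans (by rw [e']; nlinarith [abs_nonneg (L (u' x)), sq_nonneg x]) (hC' x)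
  rw [e', e'']
  exact morawetz_real P P' P'' d hP hP' hP'' (hd u) (hd u') hmul hzero

lemma integrable_mul_conj_mul_bcf (v w : SchwartzMap ℝ ℂ) (b : ℝ →ᵇ ℝ) :
    MeasureTheory.Integrable fun x => v x * (starRingEnd ℂ) (w x) * (b x : ℂ) := by
  refine (v.integrable.mul_bdd (c := SchwartzMap.seminorm ℝ 0 0 w)
    (Complex.continuous_conj.comp w.continuous).aestronglyMeasurable
    (Filter.Eventually.of_forall fun x => ?_)).mul_bdd (c := ‖b‖)
    (Complex.continuous_ofReal.comp b.continuous).aestronglyMeasurable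
    (Filter.Eventually.of_forall fun x => ?_)
  · simpa using w.norm_le_seminorm ℝ x
  · simpa using b.norm_coe_le_norm x

/-- Morawetz-type repulsivity for odd functions on `ℝ`:
`∫ (⟨x⟩⁻²|∂ₓu|² + ⟨x⟩⁻⁴|u|²) ≤ C · Re ∫ (−∂ₓₓu) conj(Λ_ψ u)` for every odd Schwartz `u`. -/
theorem stmt3 :
    ∃ δ ∈ Set.Ioo (0 : ℝ) 1, ∃ C : ℝ, 0 < C ∧
      ∀ u : SchwartzMap ℝ ℂ, (∀ x : ℝ, u (-x) = -u x) →
        (∫ x : ℝ, ((Real.sqrt (1 + x ^ 2))⁻¹ ^ 2 * ‖deriv (fun y => u y) x‖ ^ 2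
            + (Real.sqrt (1 + x ^ 2))⁻¹ ^ 4 * ‖u x‖ ^ 2))
          ≤ C * (∫ x : ℝ, (-deriv (deriv (fun y => u y)) x) *
              (starRingEnd ℂ) (LamPsi δ (fun y => u y) x)).re := by
  refine ⟨1 / 4, by norm_num, 224, by norm_num, fun u hu => ?_⟩
  have h0 : u 0 = 0 := by simpa [self_eq_neg] using hu 0
  obtain ⟨iE, iN, h⟩ := morawetz_comp Complex.reCLM Complex.abs_re_le_norm u h0
  obtain ⟨jE, jN, k⟩ := morawetz_comp Complex.imCLM Complex.abs_im_le_norm u h0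
  have hint : MeasureTheory.Integrable (fun x : ℝ => (-deriv (deriv (fun y => u y)) x) *
      (starRingEnd ℂ) (LamPsi (1 / 4) (fun y => u y) x)) := by
    have h1 := integrable_mul_conj_mul_bcf (SchwartzMap.derivCLM ℝ ℂ (SchwartzMap.derivCLM ℝ ℂ u))
      (SchwartzMap.derivCLM ℝ ℂ u)
      (mulInvBracketBCF - (1 / 4 : ℝ) • (mulInvBracketBCF * invBracketBCF))
    have h2 := integrable_mul_conj_mul_bcf (SchwartzMap.derivCLM ℝ ℂ (SchwartzMap.derivCLM ℝ ℂ u))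
      u ((1 / 2 : ℝ) • (invBracketBCF ^ 3
        + (1 / 4 : ℝ) • (invBracketBCF ^ 2 - (2 : ℝ) • invBracketBCF ^ 4)))
    have e (v : SchwartzMap ℝ ℂ) : ⇑(SchwartzMap.derivCLM ℝ ℂ v) = deriv v := rfl
    refine (h1.add h2).neg.congr (Filter.Eventually.of_forall fun x => ?_)
    simp only [LamPsi, deriv_deriv_psiW]
    simp only [deriv_psiW, e, Pi.neg_apply, Pi.add_apply, map_add, map_mul, Complex.conj_ofReal]
    simp
    ring
  have hre : (∫ x : ℝ, (-deriv (deriv (fun y => u y)) x) *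
      (starRingEnd ℂ) (LamPsi (1 / 4) (fun y => u y) x)).re =
      ∫ x : ℝ, ((-deriv (deriv (fun y => u y)) x) *
        (starRingEnd ℂ) (LamPsi (1 / 4) (fun y => u y) x)).re :=
    (integral_re hint).symm
  have hN := MeasureTheory.integral_add iN jN
  have hE := MeasureTheory.integral_add iE jE
  calc _ = _ := ?_
    _ ≤ _ := add_le_add h k
    _ = _ := ?_
  · rw [← hE]
    congr 1 with x
    simp only [invBracket, Complex.sq_norm, Complex.normSq_apply, Complex.reCLM_apply,
      Complex.imCLM_apply]
    ring
  · rw [hre, ← mul_add, ← hN]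
    congr 2 with x
    simp [LamPsi, -Complex.ofReal_div]
    ring
end

section
/- For every v ∈ 𝒮(ℝ;ℂ): ∫_ℝ | ∂ₓv + ½·H(|v|²)·v |² dx = ∫_ℝ ( |∂ₓv|² − ½·|D|(|v|²)·|v|² + (1/12)·|v|⁶ ) dx. (Both sides equal twice the conserved energy E(v) of the gauge-transformed Calogero–Moser derivative NLS, exhibiting its self-dual complete-square form.) -/
open MeasureTheory Filter Topology

/-- The Hilbert transform, realized as a principal-value integral:
`Hf(x) = (1/π) p.v. ∫ f(y)/(x-y) dy`. -/
noncomputable def pvH (f : ℝ → ℂ) (x : ℝ) : ℂ :=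
  limUnder (nhdsWithin (0 : ℝ) (Set.Ioi 0)) fun ε : ℝ =>
    (Real.pi : ℂ)⁻¹ * ∫ y in {y : ℝ | ε < |x - y|}, f y / ((x - y : ℝ) : ℂ)

/-- `|D| f := H(∂ₓ f)`, the Fourier multiplier with symbol `|ξ|`. -/
noncomputable def absD (f : ℝ → ℂ) : ℝ → ℂ := pvH (deriv f)

open SchwartzMap

/-- The Hilbert transform of a real Schwartz function, written as an absolutely convergent
integral. -/
noncomputable def symmHilbert (f : 𝓢(ℝ, ℝ)) (x : ℝ) : ℝ :=
  (2 * Real.pi)⁻¹ * ∫ u : ℝ, (f (x - u) - f (x + u)) * u⁻¹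

/-- The Cauchy integral of a real Schwartz function. -/
noncomputable def cauchyTransform (f : 𝓢(ℝ, ℝ)) (z : ℂ) : ℂ :=
  Complex.I / Real.pi * ∫ y : ℝ, (f y : ℂ) / (z - y)

lemma exists_abs_le (f : 𝓢(ℝ, ℝ)) : ∃ M, 0 ≤ M ∧ ∀ x, |f x| ≤ M :=
  ⟨SchwartzMap.seminorm ℝ 0 0 f, apply_nonneg _ _, fun x => norm_le_seminorm ℝ f x⟩

lemma exists_abs_deriv_le (f : 𝓢(ℝ, ℝ)) : ∃ M, 0 ≤ M ∧ ∀ x, |deriv f x| ≤ M := by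
  obtain ⟨M, h0, h⟩ := exists_abs_le (derivCLM ℝ ℝ f)
  exact ⟨M, h0, fun x => by simpa using h x⟩

lemma abs_sub_le_of_abs_deriv_le (f : 𝓢(ℝ, ℝ)) {M : ℝ} (h : ∀ x, |deriv f x| ≤ M) (a b : ℝ) :
    |f a - f b| ≤ M * |a - b| := by
  have := Convex.norm_image_sub_le_of_norm_deriv_le (f := f) (s := Set.univ) (x := b) (y := a)
    (C := M) (fun x _ => f.differentiableAt) (fun x _ => h x) convex_univ trivial trivial
  simpa using this

/-- Symmetric difference quotients of a Schwartz function are dominated by integrable functions of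
uniformly bounded integral. -/
lemma exists_dominating_symm_difference (f : 𝓢(ℝ, ℝ)) :
    ∃ C, ∀ x, ∃ b : ℝ → ℝ, Integrable b ∧ ∫ u, b u ≤ C ∧
      ∀ u, |f (x - u) - f (x + u)| * |u|⁻¹ ≤ b u := by
  obtain ⟨M, hM0, hM⟩ := exists_abs_deriv_le f
  refine ⟨4 * M + 2 * ∫ y, |f y|, fun x => ⟨fun u => (Set.Icc (-1 : ℝ) 1).indicator
    (fun _ => 2 * M) u + (|f (x - u)| + |f (x + u)|), ?_, ?_, ?_⟩⟩
  · have h1 : Integrable (fun u => |f (x - u)|) := (f.integrable.abs).comp_sub_left x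
    have h2 : Integrable (fun u => |f (x + u)|) := (f.integrable.abs).comp_add_left x
    have h3 : Integrable ((Set.Icc (-1 : ℝ) 1).indicator (fun _ => 2 * M)) := by
      rw [integrable_indicator_iff measurableSet_Icc]
      exact integrableOn_const (by simp)
    exact h3.add (h1.add h2)
  · have h1 : Integrable (fun u => |f (x - u)|) := (f.integrable.abs).comp_sub_left x
    have h2 : Integrable (fun u => |f (x + u)|) := (f.integrable.abs).comp_add_left x
    have h3 : Integrable ((Set.Icc (-1 : ℝ) 1).indicator (fun _ => 2 * M)) := by
      rw [integrable_indicator_iff measurableSet_Icc]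
      exact integrableOn_const (by simp)
    have e : ∫ u, ((Set.Icc (-1 : ℝ) 1).indicator (fun _ => 2 * M) u + (|f (x - u)| + |f (x + u)|))
        = 4 * M + 2 * ∫ y, |f y| := by
      rw [integral_add h3 (by exact h1.add h2), integral_add h1 h2,
        integral_indicator measurableSet_Icc, integral_sub_left_eq_self (fun y => |f y|),
        integral_add_left_eq_self (fun y => |f y|)]
      simp
      ring
    exact e.le
  · intro u
    by_cases hu : u ∈ Set.Icc (-1 : ℝ) 1
    · simp only [Set.indicator_of_mem hu]
      have h := abs_sub_le_of_abs_deriv_le f hM (x - u) (x + u)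
      have h2 : |f (x - u) - f (x + u)| * |u|⁻¹ ≤ 2 * M := by
        rcases eq_or_ne u 0 with rfl | h0
        · simp; positivity
        · rw [← div_eq_mul_inv, div_le_iff₀ (abs_pos.2 h0)]
          rw [show x - u - (x + u) = -2 * u by ring, abs_mul] at h
          norm_num at h
          linarith
      have := abs_nonneg (f (x - u)); have := abs_nonneg (f (x + u))
      linarith
    · simp only [Set.indicator_of_notMem hu, zero_add]
      have h1 : 1 ≤ |u| := by
        by_contra hc
        exact hu (abs_le.1 (not_le.1 hc).le)
      calc _ ≤ |f (x - u) - f (x + u)| * 1 := by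
            gcongr; exact inv_le_one_of_one_le₀ h1
        _ ≤ _ := by rw [mul_one]; exact abs_sub _ _

lemma Integrable.mul_of_abs_le {f k : ℝ → ℝ} (hf : Integrable f) (hk : Measurable k) {M : ℝ}
    (hM : ∀ u, |k u| ≤ M) : Integrable fun u => f u * k u :=
  hf.mul_bdd (c := M) hk.aestronglyMeasurable (Eventually.of_forall hM)

/-- Convolution with a bounded odd kernel, in symmetrized form. -/
lemma integral_mul_odd_kernel (f : 𝓢(ℝ, ℝ)) (x : ℝ) {k : ℝ → ℝ} (hk : Measurable k) {M : ℝ}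
    (hM : ∀ u, |k u| ≤ M) (hodd : ∀ u, k (-u) = -k u) :
    ∫ y, f y * k (x - y) = 2⁻¹ * ∫ u, (f (x - u) - f (x + u)) * k u := by
  have h1 : ∫ y, f y * k (x - y) = ∫ u, f (x - u) * k u := by
    rw [← integral_sub_left_eq_self (fun u => f (x - u) * k u) volume x]
    simp
  have h2 : ∫ u, f (x - u) * k u = - ∫ u, f (x + u) * k u := by
    rw [← integral_neg_eq_self, ← integral_neg]
    simp [hodd]
  have i1 : Integrable fun u => f (x - u) * k u :=
    Integrable.mul_of_abs_le (f.integrable.comp_sub_left x) hk hM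
  have i2 : Integrable fun u => f (x + u) * k u :=
    Integrable.mul_of_abs_le (f.integrable.comp_add_left x) hk hM
  simp_rw [sub_mul]
  rw [integral_sub i1 i2, h1]
  linarith

lemma exists_abs_integral_symm_difference_le (f : 𝓢(ℝ, ℝ)) :
    ∃ C, 0 ≤ C ∧ ∀ (k : ℝ → ℝ) (_ : ∀ u, |k u| ≤ |u|⁻¹) (x : ℝ),
      |∫ u, (f (x - u) - f (x + u)) * k u| ≤ C := by
  obtain ⟨C, hC⟩ := exists_dominating_symm_difference f
  refine ⟨max C 0, le_max_right _ _, fun k hk x => ?_⟩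
  obtain ⟨b, hb, hbC, hle⟩ := hC x
  refine (norm_integral_le_of_norm_le (f := fun u => (f (x - u) - f (x + u)) * k u) hb (Eventually.of_forall fun u => ?_)).trans
    (hbC.trans (le_max_left _ _))
  rw [Real.norm_eq_abs, abs_mul]
  exact (mul_le_mul_of_nonneg_left (hk u) (abs_nonneg _)).trans (hle u)

lemma tendsto_integral_symm_difference (f : 𝓢(ℝ, ℝ)) (x : ℝ) {k : ℝ → ℝ → ℝ}
    (hm : ∀ ε, Measurable (k ε)) (hk : ∀ ε u, |k ε u| ≤ |u|⁻¹)
    (hlim : ∀ u ≠ 0, Tendsto (fun ε => k ε u) (𝓝[>] 0) (𝓝 u⁻¹)) :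
    Tendsto (fun ε => ∫ u, (f (x - u) - f (x + u)) * k ε u) (𝓝[>] 0)
      (𝓝 (∫ u, (f (x - u) - f (x + u)) * u⁻¹)) := by
  obtain ⟨C, hC⟩ := exists_dominating_symm_difference f
  obtain ⟨b, hb, -, hle⟩ := hC x
  have hc : Continuous fun u => f (x - u) - f (x + u) := by
    have := f.continuous
    fun_prop
  refine tendsto_integral_filter_of_dominated_convergence b
    (Eventually.of_forall fun ε => (hc.measurable.mul (hm ε)).aestronglyMeasurable)
    (Eventually.of_forall fun ε => Eventually.of_forall fun u => ?_) hb ?_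
  · rw [Real.norm_eq_abs, abs_mul]
    exact (mul_le_mul_of_nonneg_left (hk ε u) (abs_nonneg _)).trans (hle u)
  · have : ∀ᵐ u : ℝ, u ≠ 0 := by simp [ae_iff]
    filter_upwards [this] with u hu
    exact (hlim u hu).const_mul _

/-- The principal-value integral of a real Schwartz function converges. -/
lemma pvH_ofReal (f : 𝓢(ℝ, ℝ)) (x : ℝ) :
    pvH (fun y => (f y : ℂ)) x = (symmHilbert f x : ℂ) := by
  let k : ℝ → ℝ → ℝ := fun ε => {u : ℝ | ε < |u|}.indicator fun u => u⁻¹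
  have hms : ∀ ε : ℝ, MeasurableSet {u : ℝ | ε < |u|} := fun ε =>
    measurableSet_lt measurable_const measurable_abs
  have hm : ∀ ε, Measurable (k ε) := fun ε => measurable_inv.indicator (hms ε)
  have hk : ∀ ε u, |k ε u| ≤ |u|⁻¹ := fun ε u => by
    simp only [k, Set.indicator_apply]
    split_ifs <;> simp [abs_inv]
  have hlim : ∀ u ≠ 0, Tendsto (fun ε => k ε u) (𝓝[>] 0) (𝓝 u⁻¹) := fun u hu => by
    refine tendsto_const_nhds.congr' ?_
    filter_upwards [Ioo_mem_nhdsGT (abs_pos.2 hu)] with ε hε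
    exact (Set.indicator_of_mem (s := {u : ℝ | ε < |u|}) hε.2 _).symm
  have key : Tendsto (fun ε : ℝ => (Real.pi : ℂ)⁻¹ *
      ∫ y in {y : ℝ | ε < |x - y|}, (f y : ℂ) / ((x - y : ℝ) : ℂ)) (𝓝[>] 0)
      (𝓝 (symmHilbert f x : ℂ)) := by
    have h := (((tendsto_integral_symm_difference f x hm hk hlim).const_mul
      (2 * Real.pi)⁻¹).ofReal)
    refine h.congr' ?_
    filter_upwards [self_mem_nhdsWithin] with ε hε
    have hε : 0 < ε := hε
    have hb : ∀ u, |k ε u| ≤ ε⁻¹ := fun u => by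
      simp only [k, Set.indicator_apply, Set.mem_ofPred_eq]
      split_ifs with h
      · rw [abs_inv]; exact inv_anti₀ hε h.le
      · simp; positivity
    have hodd : ∀ u, k ε (-u) = -k ε u := fun u => by
      simp only [k, Set.indicator_apply, Set.mem_ofPred_eq, abs_neg]
      split_ifs <;> simp [inv_neg]
    have e := integral_mul_odd_kernel f x (hm ε) hb hodd
    have e2 : ∫ y in {y : ℝ | ε < |x - y|}, (f y : ℂ) / ((x - y : ℝ) : ℂ)
        = ((∫ y, f y * k ε (x - y) : ℝ) : ℂ) := by
      have hmx : MeasurableSet {y : ℝ | ε < |x - y|} :=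
        measurableSet_lt measurable_const (measurable_const.sub measurable_id).abs
      rw [← integral_indicator hmx, ← integral_complex_ofReal]
      congr 1
      ext y
      by_cases hy : ε < |x - y|
      · rw [Set.indicator_of_mem (s := {y : ℝ | ε < |x - y|}) hy]
        simp only [k]
        rw [Set.indicator_of_mem (s := {u : ℝ | ε < |u|}) hy]
        push_cast
        rw [div_eq_mul_inv]
      · rw [Set.indicator_of_notMem (s := {y : ℝ | ε < |x - y|}) hy]
        simp only [k]
        rw [Set.indicator_of_notMem (s := {u : ℝ | ε < |u|}) hy]
        simp
    rw [e2, e]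
    push_cast
    rw [mul_inv]
    ring
  exact key.limUnder_eq

lemma abs_conjugate_kernel_le (ε u : ℝ) : |u / (u ^ 2 + ε ^ 2)| ≤ |u|⁻¹ := by
  rcases eq_or_ne u 0 with rfl | hu
  · simp
  · have h := abs_pos.2 hu
    rw [abs_div, abs_of_pos (by positivity : 0 < u ^ 2 + ε ^ 2), div_le_iff₀ (by positivity),
      ← sq_abs u]
    field_simp
    nlinarith [sq_nonneg ε]

lemma abs_conjugate_kernel_le_inv {ε : ℝ} (hε : 0 < ε) (u : ℝ) :
    |u / (u ^ 2 + ε ^ 2)| ≤ ε⁻¹ := by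
  rw [abs_div, abs_of_pos (by positivity : 0 < u ^ 2 + ε ^ 2), div_le_iff₀ (by positivity),
    ← sq_abs u, inv_mul_eq_div, le_div_iff₀ hε]
  nlinarith [sq_nonneg (|u| - ε), abs_nonneg u]

lemma abs_poisson_kernel_le_inv {ε : ℝ} (hε : 0 < ε) (u : ℝ) :
    |ε / (u ^ 2 + ε ^ 2)| ≤ ε⁻¹ := by
  rw [abs_of_pos (by positivity), div_le_iff₀ (by positivity), inv_mul_eq_div, le_div_iff₀ hε]
  nlinarith [sq_nonneg u]

/-- The Poisson extension in rescaled form. -/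
lemma integral_mul_poisson_kernel (f : 𝓢(ℝ, ℝ)) (x : ℝ) {ε : ℝ} (hε : 0 < ε) :
    ∫ y, f y * (ε / ((x - y) ^ 2 + ε ^ 2)) = ∫ t, f (x - ε * t) * (1 + t ^ 2)⁻¹ := by
  have h1 : ∫ y, f y * (ε / ((x - y) ^ 2 + ε ^ 2))
      = ∫ u, f (x - u) * (ε / (u ^ 2 + ε ^ 2)) := by
    rw [← integral_sub_left_eq_self (fun u => f (x - u) * (ε / (u ^ 2 + ε ^ 2))) volume x]
    simp
  have h2 := Measure.integral_comp_mul_left (fun u => f (x - u) * (ε / (u ^ 2 + ε ^ 2))) ε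
  rw [h1]
  rw [abs_of_pos (by positivity), smul_eq_mul, eq_inv_mul_iff_mul_eq₀ hε.ne'] at h2
  rw [← h2, ← integral_const_mul]
  congr 1
  ext t
  field_simp
  ring

lemma integrable_poisson (f : 𝓢(ℝ, ℝ)) (x ε : ℝ) :
    Integrable fun t => f (x - ε * t) * (1 + t ^ 2)⁻¹ := by
  obtain ⟨M, -, hM⟩ := exists_abs_le f
  have hc : Continuous fun t => f (x - ε * t) := by
    have := f.continuous
    fun_prop
  exact integrable_inv_one_add_sq.bdd_mul (c := M) hc.aestronglyMeasurable
    (Eventually.of_forall fun t => hM _)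

lemma exists_abs_poisson_le (f : 𝓢(ℝ, ℝ)) :
    ∃ C, 0 ≤ C ∧ ∀ x ε, |∫ t, f (x - ε * t) * (1 + t ^ 2)⁻¹| ≤ C := by
  obtain ⟨M, hM0, hM⟩ := exists_abs_le f
  refine ⟨∫ t : ℝ, M * (1 + t ^ 2)⁻¹, integral_nonneg fun t => by positivity, fun x ε => ?_⟩
  refine norm_integral_le_of_norm_le (f := fun t => f (x - ε * t) * (1 + t ^ 2)⁻¹)
    (integrable_inv_one_add_sq.const_mul M) (Eventually.of_forall fun t => ?_)
  rw [Real.norm_eq_abs, abs_mul, abs_of_pos (by positivity : 0 < (1 + t ^ 2)⁻¹)]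
  exact mul_le_mul_of_nonneg_right (hM _) (by positivity)

lemma tendsto_poisson (f : 𝓢(ℝ, ℝ)) (x : ℝ) :
    Tendsto (fun ε => ∫ t, f (x - ε * t) * (1 + t ^ 2)⁻¹) (𝓝[>] 0) (𝓝 (f x * Real.pi)) := by
  obtain ⟨M, hM0, hM⟩ := exists_abs_le f
  rw [← integral_univ_inv_one_add_sq, ← integral_const_mul]
  refine tendsto_integral_filter_of_dominated_convergence (fun t => M * (1 + t ^ 2)⁻¹)
    (Eventually.of_forall fun ε => (integrable_poisson f x ε).aestronglyMeasurable)
    (Eventually.of_forall fun ε => Eventually.of_forall fun t => ?_)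
    (integrable_inv_one_add_sq.const_mul M) (Eventually.of_forall fun t => ?_)
  · rw [Real.norm_eq_abs, abs_mul, abs_of_pos (by positivity : 0 < (1 + t ^ 2)⁻¹)]
    exact mul_le_mul_of_nonneg_right (hM _) (by positivity)
  · have hc : Continuous fun ε => f (x - ε * t) * (1 + t ^ 2)⁻¹ := by
      have := f.continuous
      fun_prop
    simpa using (hc.tendsto 0).mono_left nhdsWithin_le_nhds

/-- Real and imaginary parts of the Cauchy integral: the Poisson and conjugate Poisson extensions. -/
lemma cauchyTransform_eq (f : 𝓢(ℝ, ℝ)) (x : ℝ) {ε : ℝ} (hε : 0 < ε) :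
    cauchyTransform f (x + ε * Complex.I)
      = ((Real.pi⁻¹ * ∫ t, f (x - ε * t) * (1 + t ^ 2)⁻¹ : ℝ) : ℂ)
        + (((2 * Real.pi)⁻¹ * ∫ u, (f (x - u) - f (x + u)) * (u / (u ^ 2 + ε ^ 2)) : ℝ) : ℂ)
          * Complex.I := by
  have hodd := integral_mul_odd_kernel f x (k := fun u => u / (u ^ 2 + ε ^ 2))
    (by fun_prop) (abs_conjugate_kernel_le_inv hε) (fun u => by ring)
  have ia : Integrable fun y => f y * ((x - y) / ((x - y) ^ 2 + ε ^ 2)) :=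
    Integrable.mul_of_abs_le f.integrable (by fun_prop)
      (fun y => abs_conjugate_kernel_le_inv hε (x - y))
  have ib : Integrable fun y => f y * (ε / ((x - y) ^ 2 + ε ^ 2)) :=
    Integrable.mul_of_abs_le f.integrable (by fun_prop)
      (fun y => abs_poisson_kernel_le_inv hε (x - y))
  have e : ∫ y : ℝ, (f y : ℂ) / (x + ε * Complex.I - y)
      = ((∫ y, f y * ((x - y) / ((x - y) ^ 2 + ε ^ 2)) : ℝ) : ℂ)
        - ((∫ y, f y * (ε / ((x - y) ^ 2 + ε ^ 2)) : ℝ) : ℂ) * Complex.I := by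
    rw [← integral_complex_ofReal, ← integral_complex_ofReal, ← integral_mul_const,
      ← integral_sub ia.ofReal (ib.ofReal.mul_const _)]
    congr 1
    ext y
    have h1 : (x : ℂ) + ε * Complex.I - y ≠ 0 := fun h => by
      have := congrArg Complex.im h
      simp at this
      exact hε.ne' this
    have h2 : ((x : ℂ) - y) ^ 2 + ε ^ 2 ≠ 0 := by
      have : (x - y) ^ 2 + ε ^ 2 ≠ 0 := by positivity
      exact_mod_cast this
    push_cast
    field_simp
    linear_combination ((f y : ℂ) * ε ^ 2) * Complex.I_sq
  have hpi : (Real.pi : ℂ) ≠ 0 := by exact_mod_cast Real.pi_ne_zero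
  rw [cauchyTransform, e, hodd, integral_mul_poisson_kernel f x hε]
  generalize ∫ t, f (x - ε * t) * (1 + t ^ 2)⁻¹ = P
  push_cast
  field_simp
  linear_combination (-2 * (P : ℂ)) * Complex.I_sq

lemma tendsto_cauchyTransform (f : 𝓢(ℝ, ℝ)) (x : ℝ) :
    Tendsto (fun ε : ℝ => cauchyTransform f (x + ε * Complex.I)) (𝓝[>] 0)
      (𝓝 ((f x : ℂ) + symmHilbert f x * Complex.I)) := by
  have h1 := ((tendsto_poisson f x).const_mul Real.pi⁻¹).ofReal
  have h2 := ((tendsto_integral_symm_difference f x (k := fun ε u => u / (u ^ 2 + ε ^ 2))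
    (fun ε => by fun_prop) abs_conjugate_kernel_le (fun u hu => by
      have hc : ContinuousAt (fun ε : ℝ => u / (u ^ 2 + ε ^ 2)) 0 := by
        refine ContinuousAt.div (by fun_prop) (by fun_prop) ?_
        positivity
      have h := hc.tendsto.mono_left (nhdsWithin_le_nhds (s := Set.Ioi 0))
      have e : u / (u ^ 2 + 0 ^ 2) = u⁻¹ := by field_simp; ring
      rwa [e] at h)).const_mul (2 * Real.pi)⁻¹).ofReal
  have h := h1.add (h2.mul_const Complex.I)
  have e : Real.pi⁻¹ * (f x * Real.pi) = f x := by field_simp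
  rw [e] at h
  refine h.congr' ?_
  filter_upwards [self_mem_nhdsWithin] with ε hε
  exact (cauchyTransform_eq f x hε).symm

lemma exists_norm_cauchyTransform_le (f : 𝓢(ℝ, ℝ)) :
    ∃ C, 0 ≤ C ∧ ∀ z : ℂ, 0 < z.im → ‖cauchyTransform f z‖ ≤ C := by
  obtain ⟨A, hA0, hA⟩ := exists_abs_poisson_le f
  obtain ⟨B, hB0, hB⟩ := exists_abs_integral_symm_difference_le f
  refine ⟨Real.pi⁻¹ * A + (2 * Real.pi)⁻¹ * B, by positivity, fun z hz => ?_⟩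
  rw [← Complex.re_add_im z, cauchyTransform_eq f z.re hz]
  refine (norm_add_le _ _).trans ?_
  rw [norm_mul, Complex.norm_I, mul_one, Complex.norm_real, Complex.norm_real, Real.norm_eq_abs,
    Real.norm_eq_abs, abs_mul, abs_mul, abs_of_pos (by positivity : 0 < Real.pi⁻¹),
    abs_of_pos (by positivity : 0 < (2 * Real.pi)⁻¹)]
  gcongr
  · exact hA _ _
  · exact hB _ (abs_conjugate_kernel_le _) _

lemma sub_ofReal_ne_zero {z : ℂ} (hz : 0 < z.im) (y : ℝ) : z - y ≠ 0 := fun h => by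
  have := congrArg Complex.im h
  simp at this
  exact hz.ne' this

lemma im_le_norm_sub_ofReal (z : ℂ) (y : ℝ) : z.im ≤ ‖z - y‖ := by
  have := Complex.abs_im_le_norm (z - y)
  simp at this
  exact (le_abs_self _).trans this

lemma integrable_cauchy_kernel (f : 𝓢(ℝ, ℝ)) {z : ℂ} (hz : 0 < z.im) :
    Integrable fun y : ℝ => (f y : ℂ) / (z - y) := by
  simp_rw [div_eq_mul_inv]
  have hc : Continuous fun y : ℝ => (z - y)⁻¹ :=
    Continuous.inv₀ (by fun_prop) (sub_ofReal_ne_zero hz)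
  refine f.integrable.ofReal.mul_bdd (c := z.im⁻¹) hc.aestronglyMeasurable
    (Eventually.of_forall fun y => ?_)
  rw [norm_inv]
  exact inv_anti₀ hz (im_le_norm_sub_ofReal z y)

lemma mul_cauchyTransform (f : 𝓢(ℝ, ℝ)) {z : ℂ} (hz : 0 < z.im) :
    z * cauchyTransform f z = Complex.I / Real.pi * (∫ y, f y : ℝ)
      + cauchyTransform (smulLeftCLM ℝ (fun y : ℝ => y) f) z := by
  have e : ∀ y : ℝ, ((smulLeftCLM ℝ (fun y : ℝ => y) f y : ℝ) : ℂ) / (z - y)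
      = z * ((f y : ℂ) / (z - y)) - f y := fun y => by
    rw [smulLeftCLM_apply_apply (by fun_prop)]
    have := sub_ofReal_ne_zero hz y
    simp only [smul_eq_mul]
    push_cast
    field_simp
    ring
  have hf : Integrable fun y => (f y : ℂ) := f.integrable.ofReal
  simp only [cauchyTransform, e]
  rw [integral_sub ((integrable_cauchy_kernel f hz).const_mul z) hf,
    integral_const_mul, integral_complex_ofReal]
  ring

/-- Uniform decay of the Cauchy integral in the upper half-plane. -/
lemma exists_one_add_norm_mul_cauchyTransform_le (f : 𝓢(ℝ, ℝ)) :
    ∃ C, 0 ≤ C ∧ ∀ z : ℂ, 0 < z.im → (1 + ‖z‖) * ‖cauchyTransform f z‖ ≤ C := by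
  obtain ⟨A, hA0, hA⟩ := exists_norm_cauchyTransform_le f
  obtain ⟨B, hB0, hB⟩ := exists_norm_cauchyTransform_le (smulLeftCLM ℝ (fun y : ℝ => y) f)
  refine ⟨A + (‖Complex.I / Real.pi * (∫ y, f y : ℝ)‖ + B), by positivity, fun z hz => ?_⟩
  rw [add_mul, one_mul, ← norm_mul, mul_cauchyTransform f hz]
  exact add_le_add (hA z hz) ((norm_add_le _ _).trans (add_le_add le_rfl (hB z hz)))

lemma differentiableAt_cauchyTransform (f : 𝓢(ℝ, ℝ)) {z : ℂ} (hz : 0 < z.im) :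
    DifferentiableAt ℂ (cauchyTransform f) z := by
  have hs : {w : ℂ | z.im / 2 < w.im} ∈ 𝓝 z :=
    (isOpen_lt continuous_const Complex.continuous_im).mem_nhds (by simpa using hz)
  have hpos : ∀ w ∈ {w : ℂ | z.im / 2 < w.im}, 0 < w.im := fun w hw =>
    (half_pos hz).trans hw
  have hc : Continuous fun y : ℝ => -(f y : ℂ) / (z - y) ^ 2 := by
    have := f.continuous
    refine Continuous.div (by fun_prop) (by fun_prop) fun y => ?_
    exact pow_ne_zero 2 (sub_ofReal_ne_zero hz y)
  have h := (hasDerivAt_integral_of_dominated_loc_of_deriv_le (μ := volume) hs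
    (F := fun (w : ℂ) (y : ℝ) => (f y : ℂ) / (w - y))
    (F' := fun (w : ℂ) (y : ℝ) => -(f y : ℂ) / (w - y) ^ 2)
    (bound := fun y => |f y| * ((z.im / 2) ^ 2)⁻¹)
    (by
      filter_upwards [hs] with w hw
      exact (integrable_cauchy_kernel f (hpos w hw)).aestronglyMeasurable)
    (integrable_cauchy_kernel f hz) hc.aestronglyMeasurable
    (Eventually.of_forall fun y w hw => by
      rw [norm_div, norm_neg, Complex.norm_real, norm_pow, Real.norm_eq_abs, div_eq_mul_inv]
      have h1 : z.im / 2 ≤ ‖w - y‖ := (le_of_lt hw).trans (im_le_norm_sub_ofReal w y)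
      have h2 : 0 < z.im / 2 := half_pos hz
      gcongr)
    (f.integrable.abs.mul_const _)
    (Eventually.of_forall fun y w hw => by
      have := (hasDerivAt_const w (f y : ℂ)).div ((hasDerivAt_id w).sub_const (y : ℂ))
        (sub_ofReal_ne_zero (hpos w hw) y)
      simp only [id, zero_mul, mul_one, zero_sub] at this
      exact this)).2
  exact (h.const_mul (Complex.I / Real.pi : ℂ)).differentiableAt

/-- The Cauchy theorem on a horizontal line, for functions decaying quadratically above it. -/
lemma integral_horizontal_line_eq_zero {G : ℂ → ℂ} {C : ℝ}
    (hd : ∀ z : ℂ, 0 < z.im → DifferentiableAt ℂ G z)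
    (hC : ∀ z : ℂ, 0 < z.im → (1 + ‖z‖ ^ 2) * ‖G z‖ ≤ C) {ε : ℝ} (hε : 0 < ε)
    (hint : Integrable fun x : ℝ => G (x + ε * Complex.I)) :
    ∫ x : ℝ, G (x + ε * Complex.I) = 0 := by
  have hle : ∀ z : ℂ, 0 < z.im → ∀ R > 0, R ≤ ‖z‖ → ‖G z‖ ≤ C / R ^ 2 := fun z hz R hR hRz => by
    rw [le_div_iff₀ (by positivity), mul_comm]
    refine le_trans ?_ (hC z hz)
    gcongr
    nlinarith
  have hlim := intervalIntegral_tendsto_integral hint tendsto_neg_atTop_atBot tendsto_id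
  have hbound : ∀ R > 0, ‖∫ x in (-R)..R, G (x + ε * Complex.I)‖ ≤ 4 * C / R := fun R hR => by
    have hrect := Complex.integral_boundary_rect_eq_zero_of_differentiableOn G
      ((-R : ℝ) + ε * Complex.I) (R + (ε + R : ℝ) * Complex.I) (fun z hz => by
        have h := hz.2
        simp only [Complex.add_im, Complex.ofReal_im, Complex.mul_im, Complex.ofReal_re,
          Complex.I_re, Complex.I_im, mul_zero, mul_one, zero_add, add_zero,
          Set.mem_preimage, Set.uIcc_of_le (by linarith : ε ≤ ε + R)] at h
        exact (hd z (hε.trans_le h.1)).differentiableWithinAt)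
    simp only [Complex.add_im, Complex.ofReal_im, Complex.mul_im, Complex.ofReal_re,
      Complex.I_re, Complex.I_im, mul_zero, mul_one, zero_add, add_zero, Complex.add_re,
      Complex.mul_re, sub_zero] at hrect
    have htop : ‖∫ x in (-R)..R, G (x + (ε + R : ℝ) * Complex.I)‖ ≤ C / R ^ 2 * |R - -R| :=
      intervalIntegral.norm_integral_le_of_norm_le_const fun x _ => hle _ (by simp; positivity) R hR
        (by
          refine le_trans ?_ (Complex.abs_im_le_norm _)
          simp
          exact le_trans (by linarith) (le_abs_self _))
    have hside : ∀ a : ℝ, |a| = R →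
        ‖∫ y in ε..(ε + R), G (a + y * Complex.I)‖ ≤ C / R ^ 2 * |ε + R - ε| := fun a ha =>
      intervalIntegral.norm_integral_le_of_norm_le_const fun y hy => by
        rw [Set.uIoc_of_le (by linarith)] at hy
        refine hle _ (by simpa using hε.trans hy.1) R hR ?_
        refine le_trans ?_ (Complex.abs_re_le_norm _)
        simp [ha]
    have hr := hside R (abs_of_pos hR)
    have hl := hside (-R) (by rw [abs_neg, abs_of_pos hR])
    have e : ∫ x in (-R)..R, G (x + ε * Complex.I)
        = (∫ x in (-R)..R, G (x + (ε + R : ℝ) * Complex.I))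
          - Complex.I • (∫ y in ε..(ε + R), G (R + y * Complex.I))
          + Complex.I • (∫ y in ε..(ε + R), G ((-R : ℝ) + y * Complex.I)) := by
      linear_combination hrect
    rw [e]
    refine (norm_add_le _ _).trans ((add_le_add (norm_sub_le _ _) le_rfl).trans ?_)
    rw [norm_smul, norm_smul, Complex.norm_I, one_mul, one_mul]
    rw [abs_of_pos (by linarith)] at htop hr hl
    calc _ ≤ C / R ^ 2 * (R - -R) + C / R ^ 2 * (ε + R - ε) + C / R ^ 2 * (ε + R - ε) := by gcongr
      _ = _ := by field_simp; ring
  have hzero : Tendsto (fun R : ℝ => ∫ x in (-R)..R, G (x + ε * Complex.I)) atTop (𝓝 0) := by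
    refine squeeze_zero_norm' ?_ (tendsto_const_nhds.div_atTop tendsto_id : Tendsto
      (fun R : ℝ => 4 * C / R) atTop (𝓝 0))
    filter_upwards [eventually_gt_atTop 0] with R hR using hbound R hR
  exact tendsto_nhds_unique hlim hzero

/-- The boundary value of a quadratically decaying holomorphic function on the upper half-plane is
integrable with vanishing integral. -/
lemma integral_boundary_value_eq_zero {G : ℂ → ℂ} {G₀ : ℝ → ℂ} {C : ℝ}
    (hd : ∀ z : ℂ, 0 < z.im → DifferentiableAt ℂ G z)
    (hC : ∀ z : ℂ, 0 < z.im → (1 + ‖z‖ ^ 2) * ‖G z‖ ≤ C)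
    (hlim : ∀ x : ℝ, Tendsto (fun ε : ℝ => G (x + ε * Complex.I)) (𝓝[>] 0) (𝓝 (G₀ x))) :
    Integrable G₀ ∧ ∫ x, G₀ x = 0 := by
  have hb : ∀ ε > (0 : ℝ), ∀ x : ℝ, ‖G (x + ε * Complex.I)‖ ≤ C * (1 + x ^ 2)⁻¹ :=
    fun ε hε x => by
      rw [← div_eq_mul_inv, le_div_iff₀ (by positivity), mul_comm]
      refine le_trans ?_ (hC (x + ε * Complex.I) (by simpa using hε))
      gcongr 1
      have := Complex.abs_re_le_norm (x + ε * Complex.I)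
      simp only [Complex.add_re, Complex.ofReal_re, Complex.mul_re, Complex.I_re, mul_zero,
        Complex.ofReal_im, Complex.I_im, mul_one, sub_self, add_zero] at this
      rw [← sq_abs x]
      gcongr
  have hcont : ∀ ε > (0 : ℝ), Continuous fun x : ℝ => G (x + ε * Complex.I) := fun ε hε => by
    rw [continuous_iff_continuousAt]
    intro x
    exact ContinuousAt.comp (g := G) (f := fun x : ℝ => (x : ℂ) + ε * Complex.I)
      (hd _ (by simpa using hε)).continuousAt (by fun_prop)
  have hbi : Integrable fun x : ℝ => C * (1 + x ^ 2)⁻¹ := integrable_inv_one_add_sq.const_mul C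
  have hm : ∀ᶠ ε : ℝ in 𝓝[>] 0,
      AEStronglyMeasurable (fun x : ℝ => G (x + ε * Complex.I)) := by
    filter_upwards [self_mem_nhdsWithin] with ε hε using (hcont ε hε).aestronglyMeasurable
  have hG₀ : AEStronglyMeasurable G₀ := by
    obtain ⟨s, hs⟩ := (𝓝[>] (0 : ℝ)).exists_seq_tendsto
    obtain ⟨N, hN⟩ := (hs.eventually hm).exists_forall_of_atTop
    refine aestronglyMeasurable_of_tendsto_ae atTop (f := fun n (x : ℝ) => G (x + s (n + N) * Complex.I))
      (fun n => hN _ (Nat.le_add_left _ _)) (Eventually.of_forall fun x => ?_)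
    exact (hlim x).comp (hs.comp (tendsto_add_atTop_nat N))
  have hlimint := tendsto_integral_filter_of_dominated_convergence _ hm
    (by filter_upwards [self_mem_nhdsWithin] with ε hε using Eventually.of_forall (hb ε hε)) hbi
    (Eventually.of_forall hlim)
  refine ⟨hbi.mono' hG₀ (Eventually.of_forall fun x => ?_), tendsto_nhds_unique hlimint ?_⟩
  · refine le_of_tendsto (hlim x).norm ?_
    filter_upwards [self_mem_nhdsWithin] with ε hε using hb ε hε x
  · refine tendsto_const_nhds.congr' ?_
    filter_upwards [self_mem_nhdsWithin] with ε hε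
    refine (integral_horizontal_line_eq_zero hd hC hε ?_).symm
    exact hbi.mono' (hcont ε hε).aestronglyMeasurable (Eventually.of_forall (hb ε hε))

lemma integral_cauchyTransform_mul (f g : 𝓢(ℝ, ℝ)) :
    Integrable (fun x => ((f x : ℂ) + symmHilbert f x * Complex.I)
      * ((g x : ℂ) + symmHilbert g x * Complex.I)) ∧
    ∫ x, ((f x : ℂ) + symmHilbert f x * Complex.I)
      * ((g x : ℂ) + symmHilbert g x * Complex.I) = 0 := by
  obtain ⟨A, hA0, hA⟩ := exists_one_add_norm_mul_cauchyTransform_le f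
  obtain ⟨B, hB0, hB⟩ := exists_one_add_norm_mul_cauchyTransform_le g
  refine integral_boundary_value_eq_zero (G := fun z => cauchyTransform f z * cauchyTransform g z)
    (C := A * B) (fun z hz => (differentiableAt_cauchyTransform f hz).mul
      (differentiableAt_cauchyTransform g hz)) (fun z hz => ?_)
    (fun x => (tendsto_cauchyTransform f x).mul (tendsto_cauchyTransform g x))
  calc (1 + ‖z‖ ^ 2) * ‖cauchyTransform f z * cauchyTransform g z‖
      ≤ (1 + ‖z‖) ^ 2 * ‖cauchyTransform f z * cauchyTransform g z‖ := by
        gcongr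
        nlinarith [norm_nonneg z]
    _ = ((1 + ‖z‖) * ‖cauchyTransform f z‖) * ((1 + ‖z‖) * ‖cauchyTransform g z‖) := by
        rw [norm_mul]; ring
    _ ≤ A * B := by gcongr <;> [exact hA z hz; exact hB z hz]

lemma integral_cauchyTransform_pow_three (f : 𝓢(ℝ, ℝ)) :
    Integrable (fun x => ((f x : ℂ) + symmHilbert f x * Complex.I) ^ 3) ∧
    ∫ x, ((f x : ℂ) + symmHilbert f x * Complex.I) ^ 3 = 0 := by
  obtain ⟨A, hA0, hA⟩ := exists_one_add_norm_mul_cauchyTransform_le f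
  refine integral_boundary_value_eq_zero (G := fun z => cauchyTransform f z ^ 3)
    (C := A ^ 3) (fun z hz => (differentiableAt_cauchyTransform f hz).pow 3) (fun z hz => ?_)
    (fun x => (tendsto_cauchyTransform f x).pow 3)
  calc (1 + ‖z‖ ^ 2) * ‖cauchyTransform f z ^ 3‖
      ≤ (1 + ‖z‖) ^ 3 * ‖cauchyTransform f z ^ 3‖ := by
        gcongr
        nlinarith [norm_nonneg z, pow_nonneg (norm_nonneg z) 2, pow_nonneg (norm_nonneg z) 3]
    _ = ((1 + ‖z‖) * ‖cauchyTransform f z‖) ^ 3 := by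
        rw [norm_pow]; ring
    _ ≤ A ^ 3 := by gcongr; exact hA z hz

lemma Integrable.schwartz_mul {g : ℝ → ℝ} (f : 𝓢(ℝ, ℝ)) (hg : AEStronglyMeasurable g) {C : ℝ}
    (hC : ∀ x, |g x| ≤ C) : Integrable fun x => f x * g x :=
  f.integrable.mul_bdd (c := C) hg (Eventually.of_forall hC)

lemma exists_abs_symmHilbert_le (f : 𝓢(ℝ, ℝ)) : ∃ C, ∀ x, |symmHilbert f x| ≤ C := by
  obtain ⟨B, hB0, hB⟩ := exists_abs_integral_symm_difference_le f
  refine ⟨(2 * Real.pi)⁻¹ * B, fun x => ?_⟩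
  rw [symmHilbert, abs_mul, abs_of_pos (by positivity : 0 < (2 * Real.pi)⁻¹)]
  gcongr
  exact hB _ (fun u => (abs_inv u).le) x

lemma measurable_symmHilbert (f : 𝓢(ℝ, ℝ)) : Measurable (symmHilbert f) := by
  have hc : Measurable fun p : ℝ × ℝ => (f (p.1 - p.2) - f (p.1 + p.2)) * p.2⁻¹ := by
    have := f.continuous.measurable
    fun_prop
  exact (hc.stronglyMeasurable.integral_prod_right' (ν := volume)).measurable.const_mul _

lemma integrable_mul_symmHilbert (f g : 𝓢(ℝ, ℝ)) : Integrable fun x => f x * symmHilbert g x := by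
  obtain ⟨C, hC⟩ := exists_abs_symmHilbert_le g
  exact Integrable.schwartz_mul f (measurable_symmHilbert g).aestronglyMeasurable hC

lemma integrable_mul_symmHilbert_sq (f g : 𝓢(ℝ, ℝ)) :
    Integrable fun x => f x * symmHilbert g x ^ 2 := by
  obtain ⟨C, hC⟩ := exists_abs_symmHilbert_le g
  refine Integrable.schwartz_mul f ((measurable_symmHilbert g).pow_const 2).aestronglyMeasurable
    (C := C ^ 2) fun x => ?_
  rw [abs_pow]
  gcongr
  exact hC x

lemma integrable_schwartz_pow_three (f : 𝓢(ℝ, ℝ)) : Integrable fun x => f x ^ 3 := by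
  obtain ⟨M, hM0, hM⟩ := exists_abs_le f
  have h := Integrable.schwartz_mul f (g := fun x => f x ^ 2) (C := M ^ 2)
    (f.continuous.pow 2).aestronglyMeasurable
    fun x => by rw [abs_pow]; gcongr; exact hM x
  refine h.congr (Eventually.of_forall fun x => ?_)
  simp only
  ring

/-- The Hilbert transform is antisymmetric. -/
lemma integral_mul_symmHilbert_comm (f g : 𝓢(ℝ, ℝ)) :
    ∫ x, f x * symmHilbert g x = -∫ x, g x * symmHilbert f x := by
  obtain ⟨hi, h0⟩ := integral_cauchyTransform_mul f g
  have h := integral_im hi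
  rw [h0] at h
  have e : ∀ x, RCLike.im (((f x : ℂ) + symmHilbert f x * Complex.I)
      * ((g x : ℂ) + symmHilbert g x * Complex.I))
      = f x * symmHilbert g x + g x * symmHilbert f x := fun x => by
    simp
    ring
  simp only [e] at h
  rw [integral_add (integrable_mul_symmHilbert f g) (integrable_mul_symmHilbert g f)] at h
  simp at h
  linarith

lemma integral_mul_symmHilbert_sq (f : 𝓢(ℝ, ℝ)) :
    ∫ x, f x * symmHilbert f x ^ 2 = (1 / 3) * ∫ x, f x ^ 3 := by
  obtain ⟨hi, h0⟩ := integral_cauchyTransform_pow_three f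
  have h := integral_re hi
  rw [h0] at h
  have e : ∀ x, RCLike.re (((f x : ℂ) + symmHilbert f x * Complex.I) ^ 3)
      = f x ^ 3 - 3 * (f x * symmHilbert f x ^ 2) := fun x => by
    have : ((f x : ℂ) + symmHilbert f x * Complex.I) ^ 3
        = ((f x ^ 3 - 3 * (f x * symmHilbert f x ^ 2) : ℝ) : ℂ)
          + ((3 * f x ^ 2 * symmHilbert f x - symmHilbert f x ^ 3 : ℝ) : ℂ) * Complex.I := by
      push_cast
      linear_combination (3 * (f x : ℂ) * symmHilbert f x ^ 2
        + symmHilbert f x ^ 3 * Complex.I) * Complex.I_sq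
    rw [this, RCLike.re_eq_complex_re, Complex.add_re, Complex.re_ofReal_mul, Complex.ofReal_re,
      Complex.I_re, mul_zero, add_zero]
  simp only [e] at h
  rw [integral_sub (integrable_schwartz_pow_three f)
    ((integrable_mul_symmHilbert_sq f f).const_mul 3), integral_const_mul] at h
  simp at h
  linarith

/-- The squared modulus of a Schwartz function, as a Schwartz function. -/
noncomputable def schwartzNormSq (v : 𝓢(ℝ, ℂ)) : 𝓢(ℝ, ℝ) := pairing (innerSL ℝ) v v

lemma schwartzNormSq_apply (v : 𝓢(ℝ, ℂ)) (x : ℝ) : schwartzNormSq v x = ‖v x‖ ^ 2 := by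
  rw [schwartzNormSq, pairing_apply_apply]
  exact real_inner_self_eq_norm_sq (v x)

lemma deriv_schwartzNormSq (v : 𝓢(ℝ, ℂ)) (x : ℝ) :
    derivCLM ℝ ℝ (schwartzNormSq v) x = 2 * inner ℝ (v x) (deriv v x) := by
  have h := (v.hasDerivAt x).norm_sq
  rw [derivCLM_apply, ← h.deriv]
  congr 1
  ext y
  exact schwartzNormSq_apply v y

/-- Self-dual, complete-square form of the energy of the gauged Calogero–Moser DNLS:
`∫ |∂ₓv + ½ H(|v|²) v|² = ∫ (|∂ₓv|² − ½ |D|(|v|²)·|v|² + (1/12)|v|⁶)` for every Schwartz `v`. -/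
theorem stmt4 (v : SchwartzMap ℝ ℂ) :
    (((∫ x : ℝ, ‖deriv (fun y => v y) x
          + (1 / 2) * pvH (fun y => ((‖v y‖ ^ 2 : ℝ) : ℂ)) x * v x‖ ^ 2) : ℝ) : ℂ)
      = ∫ x : ℝ, (((‖deriv (fun y => v y) x‖ ^ 2 : ℝ) : ℂ)
          - (1 / 2) * absD (fun y => ((‖v y‖ ^ 2 : ℝ) : ℂ)) x * ((‖v x‖ ^ 2 : ℝ) : ℂ)
          + (1 / 12) * ((‖v x‖ ^ 6 : ℝ) : ℂ)) := by
  have hρ : (fun y => ((‖v y‖ ^ 2 : ℝ) : ℂ)) = fun y => (schwartzNormSq v y : ℂ) := by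
    ext y
    rw [schwartzNormSq_apply]
  have hdρ : deriv (fun y => (schwartzNormSq v y : ℂ))
      = fun y => (derivCLM ℝ ℝ (schwartzNormSq v) y : ℂ) := by
    ext y
    rw [((schwartzNormSq v).hasDerivAt y).ofReal_comp.deriv, derivCLM_apply]
  have habs : ∀ x, absD (fun y => (schwartzNormSq v y : ℂ)) x
      = (symmHilbert (derivCLM ℝ ℝ (schwartzNormSq v)) x : ℂ) := fun x => by
    rw [absD, hdρ, pvH_ofReal]
  have hL : ∀ x, ‖deriv v x + (1 / 2) * (symmHilbert (schwartzNormSq v) x : ℂ) * v x‖ ^ 2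
      = ‖deriv v x‖ ^ 2
        + ((1 / 2) * (derivCLM ℝ ℝ (schwartzNormSq v) x * symmHilbert (schwartzNormSq v) x)
        + (1 / 4) * (schwartzNormSq v x * symmHilbert (schwartzNormSq v) x ^ 2)) := fun x => by
    have e : (1 / 2) * (symmHilbert (schwartzNormSq v) x : ℂ) * v x
        = ((1 / 2) * symmHilbert (schwartzNormSq v) x : ℝ) • v x := by
      rw [Complex.real_smul]
      push_cast
      ring
    rw [e, norm_add_sq_real, real_inner_smul_right, norm_smul, mul_pow, Real.norm_eq_abs, sq_abs,
      deriv_schwartzNormSq, schwartzNormSq_apply, real_inner_comm]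
    ring
  have hR : ∀ x, (((‖deriv v x‖ ^ 2 : ℝ) : ℂ)
          - (1 / 2) * (symmHilbert (derivCLM ℝ ℝ (schwartzNormSq v)) x : ℂ)
            * ((‖v x‖ ^ 2 : ℝ) : ℂ) + (1 / 12) * ((‖v x‖ ^ 6 : ℝ) : ℂ))
      = ((‖deriv v x‖ ^ 2
        + (-(1 / 2) * (schwartzNormSq v x * symmHilbert (derivCLM ℝ ℝ (schwartzNormSq v)) x)
          + (1 / 12) * schwartzNormSq v x ^ 3) : ℝ) : ℂ) := fun x => by
    rw [schwartzNormSq_apply]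
    push_cast
    ring
  have hi : Integrable fun x => ‖deriv v x‖ ^ 2 := by
    refine (schwartzNormSq (derivCLM ℝ ℂ v)).integrable.congr (Eventually.of_forall fun x => ?_)
    simp only [schwartzNormSq_apply, derivCLM_apply]
  have i1 := (integrable_mul_symmHilbert (derivCLM ℝ ℝ (schwartzNormSq v))
    (schwartzNormSq v)).const_mul (1 / 2)
  have i2 := (integrable_mul_symmHilbert_sq (schwartzNormSq v) (schwartzNormSq v)).const_mul (1 / 4)
  have i3 := (integrable_mul_symmHilbert (schwartzNormSq v)
    (derivCLM ℝ ℝ (schwartzNormSq v))).const_mul (-(1 / 2))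
  have i4 := (integrable_schwartz_pow_three (schwartzNormSq v)).const_mul (1 / 12)
  simp only [hρ, pvH_ofReal, habs]
  simp only [hL, hR]
  rw [integral_complex_ofReal, integral_add hi (by exact i1.add i2), integral_add i1 i2,
    integral_add hi (by exact i3.add i4), integral_add i3 i4]
  simp only [integral_const_mul]
  rw [integral_mul_symmHilbert_sq, integral_mul_symmHilbert_comm (schwartzNormSq v)]
  congr 1
  ring
end

section
/- For every v ∈ 𝒮(ℝ;ℂ), set w := ∂ₓv + ½·H(|v|²)·v. Then the pointwise identity −∂ₓw + ½·H(|v|²)·w − v·H( Re( conj(v)·w ) ) = −∂ₓₓv − |D|(|v|²)·v + ¼·|v|⁴·v holds on ℝ. In particular, ¼·( H(|v|²) )²·v − ½·H( H(|v|²)·|v|² )·v = ¼·|v|⁴·v pointwise (self-dual form of the gauged Calogero–Moser DNLS: the equation is equivalent to ∂ₜv + i L_v* 𝐃_v v = 0). -/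
open MeasureTheory Filter Topology

/-- `|v|²` as a complex-valued function. -/
noncomputable def vsq (v : ℝ → ℂ) : ℝ → ℂ := fun y => ((‖v y‖ ^ 2 : ℝ) : ℂ)

/-- The Bogomol'nyi operator `𝐃_v v = ∂ₓ v + ½ H(|v|²) v`. -/
noncomputable def Bog (v : ℝ → ℂ) : ℝ → ℂ := fun x =>
  deriv v x + (1 / 2) * pvH (vsq v) x * v x

/-- The sine integral `Si(T) = ∫₀ᵀ sin t / t dt`. -/
noncomputable def sinIntegral (T : ℝ) : ℝ := ∫ t in (0 : ℝ)..T, Real.sinc t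

theorem hasDerivAt_sinIntegral (T : ℝ) : HasDerivAt sinIntegral (Real.sinc T) T :=
  intervalIntegral.integral_hasDerivAt_right
    (Real.continuous_sinc.intervalIntegrable _ _)
    (Real.continuous_sinc.stronglyMeasurableAtFilter _ _) Real.continuous_sinc.continuousAt

theorem continuous_sinIntegral : Continuous sinIntegral :=
  continuous_iff_continuousAt.2 fun T => (hasDerivAt_sinIntegral T).continuousAt

theorem sinIntegral_zero : sinIntegral 0 = 0 := by simp [sinIntegral]

theorem sinIntegral_neg (T : ℝ) : sinIntegral (-T) = -sinIntegral T := by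
  have h := intervalIntegral.integral_comp_neg (a := 0) (b := T) (fun t => Real.sinc t)
  simp only [Real.sinc_neg, neg_zero] at h
  rw [sinIntegral, sinIntegral, h, intervalIntegral.integral_symm]

theorem integral_exp_neg_mul_sin (s T : ℝ) :
    ∫ t in (0 : ℝ)..T, Real.exp (-(t * s)) * Real.sin t =
      (1 - Real.exp (-(T * s)) * (Real.cos T + s * Real.sin T)) * (1 + s ^ 2)⁻¹ := by
  have hs : (1 + s ^ 2) ≠ 0 := by positivity
  rw [intervalIntegral.integral_eq_sub_of_hasDerivAt
    (f := fun t => -(Real.exp (-(t * s)) * (Real.cos t + s * Real.sin t)) * (1 + s ^ 2)⁻¹)]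
  · simp; ring
  · intro t _
    have h1 : HasDerivAt (fun t => Real.exp (-(t * s))) (Real.exp (-(t * s)) * (-(1 * s))) t :=
      (((hasDerivAt_id t).mul_const s).neg).exp
    have h2 : HasDerivAt (fun t => Real.cos t + s * Real.sin t)
        (-Real.sin t + s * Real.cos t) t :=
      (Real.hasDerivAt_cos t).add ((Real.hasDerivAt_sin t).const_mul s)
    refine ((h1.mul h2).neg.mul_const _).congr_deriv ?_
    field_simp
    ring
  · exact (by fun_prop : Continuous fun t : ℝ =>
      Real.exp (-(t * s)) * Real.sin t).intervalIntegrable _ _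

theorem sinIntegral_eq_integral_Ioi {T : ℝ} (hT : 0 ≤ T) :
    sinIntegral T = ∫ s in Set.Ioi (0 : ℝ),
      (1 - Real.exp (-(T * s)) * (Real.cos T + s * Real.sin T)) * (1 + s ^ 2)⁻¹ := by
  have inner : ∀ t ∈ Set.Ioc 0 T, ∀ c : ℝ,
      IntegrableOn (fun s => Real.exp (-(t * s)) * c) (Set.Ioi 0) ∧
      ∫ s in Set.Ioi (0 : ℝ), Real.exp (-(t * s)) * c = c / t := by
    intro t ht c
    have h1 := integrableOn_exp_mul_Ioi (neg_lt_zero.2 ht.1) 0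
    have h2 := integral_exp_mul_Ioi (neg_lt_zero.2 ht.1) 0
    simp only [neg_mul] at h1 h2
    refine ⟨h1.mul_const c, ?_⟩
    rw [integral_mul_const, h2]
    have := ht.1.ne'
    simp
    field_simp
  have hsinc : ∀ t ∈ Set.Ioc 0 T, Real.sinc t = Real.sin t / t :=
    fun t ht => Real.sinc_of_ne_zero ht.1.ne'
  have hint : Integrable (Function.uncurry fun t s : ℝ => Real.exp (-(t * s)) * Real.sin t)
      ((volume.restrict (Set.Ioc 0 T)).prod (volume.restrict (Set.Ioi 0))) := by
    rw [integrable_prod_iff]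
    · constructor
      · filter_upwards [ae_restrict_mem measurableSet_Ioc] with t ht
        exact (inner t ht (Real.sin t)).1
      · have : IntegrableOn (fun t => |Real.sinc t|) (Set.Ioc 0 T) :=
          (Real.continuous_sinc.abs.integrableOn_Icc).mono_set Set.Ioc_subset_Icc_self
        refine Integrable.congr this ?_
        filter_upwards [ae_restrict_mem measurableSet_Ioc] with t ht
        have := (inner t ht |Real.sin t|).2
        simp only [Function.uncurry_apply_pair, norm_mul, Real.norm_eq_abs, Real.abs_exp]
        rw [this, hsinc t ht, abs_div, abs_of_pos ht.1]
    · exact (by fun_prop : Continuous (Function.uncurry fun t s : ℝ =>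
        Real.exp (-(t * s)) * Real.sin t)).aestronglyMeasurable
  have hswap := integral_integral_swap hint
  rw [sinIntegral, intervalIntegral.integral_of_le hT]
  calc ∫ t in Set.Ioc 0 T, Real.sinc t
      = ∫ t in Set.Ioc 0 T, ∫ s in Set.Ioi (0 : ℝ), Real.exp (-(t * s)) * Real.sin t :=
        setIntegral_congr_fun measurableSet_Ioc fun t ht => by
          simp only [(inner t ht (Real.sin t)).2, hsinc t ht]
    _ = _ := hswap
    _ = _ := by
        congr 1
        ext s
        rw [← intervalIntegral.integral_of_le hT, integral_exp_neg_mul_sin]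

theorem tendsto_sinIntegral_atTop : Tendsto sinIntegral atTop (𝓝 (Real.pi / 2)) := by
  have h0 : ∫ s in Set.Ioi (0 : ℝ), (1 + s ^ 2)⁻¹ = Real.pi / 2 := by
    rw [integral_Ioi_inv_one_add_sq]; simp
  have trig : ∀ T s : ℝ, 0 < s → |Real.cos T + s * Real.sin T| ≤ 1 + s := fun T s hs => by
    refine (abs_add_le _ _).trans ?_
    rw [abs_mul, abs_of_pos hs]
    have := mul_le_mul_of_nonneg_left (Real.abs_sin_le_one T) hs.le
    linarith [Real.abs_cos_le_one T]
  rw [← h0]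
  have key : Tendsto (fun T : ℝ => ∫ s in Set.Ioi (0 : ℝ),
      (1 - Real.exp (-(T * s)) * (Real.cos T + s * Real.sin T)) * (1 + s ^ 2)⁻¹) atTop
      (𝓝 (∫ s in Set.Ioi (0 : ℝ), (1 + s ^ 2)⁻¹)) := by
    refine tendsto_integral_filter_of_dominated_convergence (fun s => 2 * (1 + s ^ 2)⁻¹)
      ?_ ?_ ((integrable_inv_one_add_sq.const_mul 2).integrableOn) ?_
    · refine Eventually.of_forall fun T => Measurable.aestronglyMeasurable (by fun_prop)
    · filter_upwards [eventually_ge_atTop 1] with T hT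
      filter_upwards [ae_restrict_mem measurableSet_Ioi] with s hs
      have hs : 0 < s := hs
      rw [norm_mul, Real.norm_eq_abs, Real.norm_of_nonneg (by positivity : (0:ℝ) ≤ (1 + s ^ 2)⁻¹)]
      gcongr
      have h1 : Real.exp (-(T * s)) * (1 + s) ≤ 1 := by
        have : 1 + s ≤ Real.exp (T * s) := by
          have := Real.add_one_le_exp (T * s)
          nlinarith
        calc Real.exp (-(T * s)) * (1 + s) ≤ Real.exp (-(T * s)) * Real.exp (T * s) := by gcongr
          _ = 1 := by rw [← Real.exp_add]; simp
      have h2 : |Real.exp (-(T * s)) * (Real.cos T + s * Real.sin T)| ≤ 1 := by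
        rw [abs_mul, Real.abs_exp]
        exact (mul_le_mul_of_nonneg_left (trig T s hs) (Real.exp_pos _).le).trans h1
      have := abs_le.1 h2
      exact abs_le.2 ⟨by linarith, by linarith⟩
    · filter_upwards [ae_restrict_mem measurableSet_Ioi] with s hs
      have hs : 0 < s := hs
      have h1 : Tendsto (fun T : ℝ => Real.exp (-(T * s)) * (1 + s)) atTop (𝓝 0) := by
        have : Tendsto (fun T : ℝ => Real.exp (-(T * s))) atTop (𝓝 0) :=
          Real.tendsto_exp_neg_atTop_nhds_zero.comp (tendsto_id.atTop_mul_const hs)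
        simpa using this.mul_const (1 + s)
      have h2 : Tendsto (fun T : ℝ => Real.exp (-(T * s)) * (Real.cos T + s * Real.sin T))
          atTop (𝓝 0) := by
        refine squeeze_zero_norm (fun T => ?_) h1
        rw [Real.norm_eq_abs, abs_mul, Real.abs_exp]
        exact mul_le_mul_of_nonneg_left (trig T s hs) (Real.exp_pos _).le
      simpa using (h2.const_sub 1).mul_const (1 + s ^ 2)⁻¹
  refine key.congr' ?_
  filter_upwards [eventually_ge_atTop 0] with T hT
  exact (sinIntegral_eq_integral_Ioi hT).symm

theorem exists_abs_sinIntegral_le : ∃ C, ∀ T, |sinIntegral T| ≤ C := by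
  obtain ⟨N, hN⟩ := eventually_atTop.1
    (tendsto_sinIntegral_atTop.abs.eventually (ge_mem_nhds (lt_add_one |Real.pi / 2|)))
  obtain ⟨C, hC⟩ := (isCompact_Icc (a := 0) (b := N)).exists_bound_of_continuousOn
    continuous_sinIntegral.continuousOn
  have pos : ∀ T, 0 ≤ T → |sinIntegral T| ≤ max (|Real.pi / 2| + 1) C := fun T hT => by
    rcases le_total N T with h | h
    · exact (hN T h).trans (le_max_left _ _)
    · exact (hC T ⟨hT, h⟩).trans (le_max_right _ _)
  refine ⟨max (|Real.pi / 2| + 1) C, fun T => ?_⟩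
  rcases le_total 0 T with h | h
  · exact pos T h
  · simpa [sinIntegral_neg] using pos (-T) (by linarith)

theorem tendsto_sinIntegral_mul (a : ℝ) :
    Tendsto (fun R => sinIntegral (a * R)) atTop (𝓝 (Real.pi / 2 * a.sign)) := by
  rcases lt_trichotomy a 0 with h | rfl | h
  · have : Tendsto (fun R => sinIntegral (-a * R)) atTop (𝓝 (Real.pi / 2)) :=
      tendsto_sinIntegral_atTop.comp (tendsto_id.const_mul_atTop (by linarith))
    simpa [Real.sign_of_neg h, sinIntegral_neg] using this.neg
  · simp [sinIntegral_zero]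
  · simpa [Real.sign_of_pos h, Function.comp_def] using
      tendsto_sinIntegral_atTop.comp (tendsto_id.const_mul_atTop h)

theorem integral_sin_div (a : ℝ) {ε R : ℝ} (hε : 0 < ε) (hR : ε ≤ R) :
    ∫ t in ε..R, Real.sin (a * t) / t = sinIntegral (a * R) - sinIntegral (a * ε) := by
  rw [intervalIntegral.integral_eq_sub_of_hasDerivAt (f := fun t => sinIntegral (a * t))]
  · intro t ht
    rw [Set.uIcc_of_le hR] at ht
    have h0 : t ≠ 0 := (hε.trans_le ht.1).ne'
    refine ((hasDerivAt_sinIntegral (a * t)).comp t ((hasDerivAt_id t).const_mul a)).congr_deriv ?_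
    rcases eq_or_ne a 0 with rfl | ha
    · simp
    · rw [Real.sinc_of_ne_zero (mul_ne_zero ha h0)]
      field_simp
  · refine ContinuousOn.intervalIntegrable ?_
    refine ContinuousOn.div (by fun_prop) continuousOn_id fun t ht => ?_
    rw [Set.uIcc_of_le hR] at ht
    exact (hε.trans_le ht.1).ne'

/-- The plane wave `e^{2πiξx}`. -/
noncomputable def planeWave (x ξ : ℝ) : ℂ :=
  Complex.exp ((2 * Real.pi * (ξ * x) : ℝ) * Complex.I)

theorem norm_planeWave (x ξ : ℝ) : ‖planeWave x ξ‖ = 1 :=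
  Complex.norm_exp_ofReal_mul_I _

theorem continuous_planeWave : Continuous fun p : ℝ × ℝ => planeWave p.1 p.2 := by
  unfold planeWave
  fun_prop

theorem planeWave_add_right (x ξ η : ℝ) :
    planeWave x (ξ + η) = planeWave x ξ * planeWave x η := by
  rw [planeWave, planeWave, planeWave, ← Complex.exp_add]
  congr 1
  push_cast
  ring

theorem planeWave_sub_sub_planeWave_add (x t ξ : ℝ) :
    planeWave (x - t) ξ - planeWave (x + t) ξ =
      planeWave x ξ * (-2 * Complex.I) * (Real.sin (2 * Real.pi * ξ * t) : ℝ) := by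
  have h1 : planeWave (x - t) ξ =
      planeWave x ξ * Complex.exp (-((2 * Real.pi * ξ * t : ℝ) : ℂ) * Complex.I) := by
    rw [planeWave, planeWave, ← Complex.exp_add]
    congr 1
    push_cast
    ring
  have h2 : planeWave (x + t) ξ =
      planeWave x ξ * Complex.exp (((2 * Real.pi * ξ * t : ℝ) : ℂ) * Complex.I) := by
    rw [planeWave, planeWave, ← Complex.exp_add]
    congr 1
    push_cast
    ring
  rw [h1, h2, Complex.ofReal_sin, Complex.sin]
  linear_combination (planeWave x ξ *
    (Complex.exp (-((2 * Real.pi * ξ * t : ℝ) : ℂ) * Complex.I) -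
      Complex.exp (((2 * Real.pi * ξ * t : ℝ) : ℂ) * Complex.I))) * Complex.I_sq

/-- The annulus `{y : ε < |x - y| ≤ R}`. -/
def annulus (x ε R : ℝ) : Set ℝ := {y | ε < |x - y| ∧ |x - y| ≤ R}

theorem measurableSet_annulus (x ε R : ℝ) : MeasurableSet (annulus x ε R) :=
  MeasurableSet.inter (s₁ := {y : ℝ | ε < |x - y|}) (s₂ := {y : ℝ | |x - y| ≤ R})
    (measurableSet_lt (by fun_prop) (by fun_prop)) (measurableSet_le (by fun_prop) (by fun_prop))

theorem annulus_eq_union {x ε R : ℝ} (hε : 0 < ε) :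
    annulus x ε R = Set.Ico (x - R) (x - ε) ∪ Set.Ioc (x + ε) (x + R) := by
  ext y
  simp only [annulus, Set.mem_ofPred_eq, Set.mem_union, Set.mem_Ico, Set.mem_Ioc, lt_abs, abs_le]
  constructor
  · rintro ⟨h | h, h1, h2⟩
    · left; constructor <;> linarith
    · right; constructor <;> linarith
  · rintro (⟨h1, h2⟩ | ⟨h1, h2⟩)
    · exact ⟨Or.inl (by linarith), by linarith, by linarith⟩
    · exact ⟨Or.inr (by linarith), by linarith, by linarith⟩

theorem integrableOn_inv_sub_annulus {x ε R : ℝ} (hε : 0 < ε) :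
    IntegrableOn (fun y : ℝ => (((x - y : ℝ) : ℂ))⁻¹) (annulus x ε R) := by
  refine Measure.integrableOn_of_bounded (M := ε⁻¹) ?_
    (Measurable.aestronglyMeasurable (by fun_prop)) ?_
  · rw [annulus_eq_union hε]
    refine ((measure_union_le _ _).trans_lt ?_).ne
    simp
  · filter_upwards [ae_restrict_mem (measurableSet_annulus x ε R)] with y hy
    rw [norm_inv, Complex.norm_real, Real.norm_eq_abs]
    exact inv_anti₀ hε hy.1.le

theorem setIntegral_annulus {h : ℝ → ℂ} {x ε R : ℝ} (hh : ContinuousOn h {x}ᶜ) (hε : 0 < ε)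
    (hR : ε ≤ R) :
    ∫ y in annulus x ε R, h y = ∫ t in ε..R, (h (x - t) + h (x + t)) := by
  have hpos : ∀ t ∈ Set.uIcc ε R, 0 < t := fun t ht => by
    rw [Set.uIcc_of_le hR] at ht
    exact hε.trans_le ht.1
  have hc1 : ContinuousOn (fun t => h (x - t)) (Set.uIcc ε R) :=
    hh.comp (by fun_prop) fun t ht => by
      have := hpos t ht
      simp only [Set.mem_compl_iff, Set.mem_singleton_iff]
      intro h; linarith
  have hc2 : ContinuousOn (fun t => h (x + t)) (Set.uIcc ε R) :=
    hh.comp (by fun_prop) fun t ht => by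
      have := hpos t ht
      simp only [Set.mem_compl_iff, Set.mem_singleton_iff]
      intro h; linarith
  have hi1 : IntegrableOn h (Set.Ico (x - R) (x - ε)) :=
    ((hh.mono fun y hy => by
      have := hy.2
      simp only [Set.mem_compl_iff, Set.mem_singleton_iff]
      intro h; linarith).integrableOn_Icc (a := x - R) (b := x - ε)).mono_set
      Set.Ico_subset_Icc_self
  have hi2 : IntegrableOn h (Set.Ioc (x + ε) (x + R)) :=
    ((hh.mono fun y hy => by
      have := hy.1
      simp only [Set.mem_compl_iff, Set.mem_singleton_iff]
      intro h; linarith).integrableOn_Icc (a := x + ε) (b := x + R)).mono_set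
      Set.Ioc_subset_Icc_self
  rw [intervalIntegral.integral_add hc1.intervalIntegrable hc2.intervalIntegrable,
    intervalIntegral.integral_comp_sub_left, intervalIntegral.integral_comp_add_left,
    annulus_eq_union hε, setIntegral_union _ measurableSet_Ioc hi1 hi2,
    integral_Ico_eq_integral_Ioc, intervalIntegral.integral_of_le (by linarith),
    intervalIntegral.integral_of_le (by linarith)]
  refine Set.disjoint_left.2 fun y h1 h2 => ?_
  have := h1.2
  have := h2.1
  linarith

theorem setIntegral_planeWave_div (x ξ : ℝ) {ε R : ℝ} (hε : 0 < ε) (hR : ε ≤ R) :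
    ∫ y in annulus x ε R, planeWave y ξ / ((x - y : ℝ) : ℂ) =
      planeWave x ξ * (-2 * Complex.I) *
        ((sinIntegral (2 * Real.pi * ξ * R) - sinIntegral (2 * Real.pi * ξ * ε) : ℝ) : ℂ) := by
  rw [setIntegral_annulus _ hε hR, ← integral_sin_div _ hε hR, ← intervalIntegral.integral_ofReal,
    ← intervalIntegral.integral_const_mul]
  · refine intervalIntegral.integral_congr fun t ht => ?_
    have h := planeWave_sub_sub_planeWave_add x t ξ
    simp only [sub_sub_cancel, sub_add_cancel_left, Complex.ofReal_neg, div_neg,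
      Complex.ofReal_div]
    rw [← sub_eq_add_neg, ← sub_div, h, mul_div_assoc]
  · have : Continuous fun y => planeWave y ξ :=
      continuous_planeWave.comp (continuous_id.prodMk continuous_const)
    refine this.continuousOn.div (by fun_prop) fun y hy => ?_
    rw [Complex.ofReal_ne_zero, sub_ne_zero]
    exact Ne.symm hy

/-- The truncated integrals defining `pvH φ x` converge to `L`. -/
def HasPVH (φ : ℝ → ℂ) (x : ℝ) (L : ℂ) : Prop :=
  Tendsto (fun ε : ℝ =>
    (Real.pi : ℂ)⁻¹ * ∫ y in {y : ℝ | ε < |x - y|}, φ y / ((x - y : ℝ) : ℂ)) (𝓝[>] 0) (𝓝 L)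

theorem HasPVH.pvH_eq {φ : ℝ → ℂ} {x : ℝ} {L : ℂ} (h : HasPVH φ x L) : pvH φ x = L :=
  h.limUnder_eq

theorem HasPVH.conj_eq {φ : ℝ → ℂ} {x : ℝ} {L : ℂ} (h : HasPVH φ x L)
    (hφ : ∀ y, (starRingEnd ℂ) (φ y) = φ y) : (starRingEnd ℂ) L = L := by
  refine tendsto_nhds_unique ((Complex.continuous_conj.tendsto L).comp h) (Tendsto.congr ?_ h)
  intro ε
  simp only [Function.comp_apply, map_mul, map_inv₀, Complex.conj_ofReal, ← integral_conj,
    map_div₀, hφ]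

theorem integrableOn_div_sub {φ : ℝ → ℂ} (hφ : Integrable φ) (x : ℝ) {ε : ℝ} (hε : 0 < ε) :
    IntegrableOn (fun y => φ y / ((x - y : ℝ) : ℂ)) {y : ℝ | ε < |x - y|} := by
  have hmeas : MeasurableSet {y : ℝ | ε < |x - y|} :=
    measurableSet_lt (by fun_prop) (by fun_prop)
  simp only [div_eq_mul_inv]
  refine Integrable.mul_bdd (c := ε⁻¹) hφ.integrableOn
    (Measurable.aestronglyMeasurable (by fun_prop)) ?_
  filter_upwards [ae_restrict_mem hmeas] with y hy
  rw [norm_inv, Complex.norm_real, Real.norm_eq_abs]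
  exact inv_anti₀ hε (le_of_lt hy)

theorem HasPVH.const_mul_add {φ ψ : ℝ → ℂ} {x : ℝ} {L M : ℂ} (hφ : HasPVH φ x L)
    (hψ : HasPVH ψ x M) (hφi : Integrable φ) (hψi : Integrable ψ) (c : ℂ) :
    HasPVH (fun y => c * (φ y + ψ y)) x (c * (L + M)) := by
  refine ((hφ.add hψ).const_mul c).congr' ?_
  filter_upwards [self_mem_nhdsWithin] with ε hε
  rw [← mul_add, ← integral_add (integrableOn_div_sub hφi x hε) (integrableOn_div_sub hψi x hε),
    mul_left_comm, ← integral_const_mul]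
  congr 2
  ext y
  ring

section FourierMultiplier

variable {Ω : Type*} [MeasurableSpace Ω] {μ : Measure Ω} {g : Ω → ℂ} {m : Ω → ℝ} {φ : ℝ → ℂ}

theorem aestronglyMeasurable_planeWave (hm : Measurable m) (x : ℝ) :
    AEStronglyMeasurable (fun ω => planeWave x (m ω)) μ :=
  (continuous_planeWave.measurable.comp (measurable_const.prodMk hm)).aestronglyMeasurable

theorem integrable_mul_planeWave (hg : Integrable g μ) (hm : Measurable m) (x : ℝ) :
    Integrable (fun ω => g ω * planeWave x (m ω)) μ :=
  hg.mul_bdd (c := 1) (aestronglyMeasurable_planeWave hm x)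
    (Eventually.of_forall fun _ => (norm_planeWave _ _).le)

theorem setIntegral_annulus_div [SFinite μ] (hg : Integrable g μ) (hm : Measurable m)
    (hφ : ∀ x, φ x = ∫ ω, g ω * planeWave x (m ω) ∂μ) (x : ℝ) {ε R : ℝ} (hε : 0 < ε)
    (hR : ε ≤ R) :
    ∫ y in annulus x ε R, φ y / ((x - y : ℝ) : ℂ) =
      ∫ ω, g ω * planeWave x (m ω) * (-2 * Complex.I *
        ((sinIntegral (2 * Real.pi * m ω * R) - sinIntegral (2 * Real.pi * m ω * ε) : ℝ) : ℂ))
        ∂μ := by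
  have hint : Integrable (Function.uncurry fun (y : ℝ) (ω : Ω) =>
      (((x - y : ℝ) : ℂ))⁻¹ * g ω * planeWave y (m ω))
      ((volume.restrict (annulus x ε R)).prod μ) :=
    ((integrableOn_inv_sub_annulus hε).mul_prod hg).mul_bdd (c := 1)
      (continuous_planeWave.measurable.comp
        (measurable_fst.prodMk (hm.comp measurable_snd))).aestronglyMeasurable
      (Eventually.of_forall fun _ => (norm_planeWave _ _).le)
  calc ∫ y in annulus x ε R, φ y / ((x - y : ℝ) : ℂ)
      = ∫ y in annulus x ε R, ∫ ω, (((x - y : ℝ) : ℂ))⁻¹ * g ω * planeWave y (m ω) ∂μ := by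
        congr 1
        ext y
        rw [hφ, div_eq_inv_mul, ← integral_const_mul]
        simp only [mul_assoc]
    _ = ∫ ω, (∫ y in annulus x ε R, (((x - y : ℝ) : ℂ))⁻¹ * g ω * planeWave y (m ω)) ∂μ :=
        integral_integral_swap hint
    _ = _ := by
        congr 1
        ext ω
        rw [mul_assoc, ← mul_assoc (planeWave x (m ω)), ← setIntegral_planeWave_div x _ hε hR,
          ← integral_const_mul]
        congr 1
        ext y
        ring

theorem setIntegral_div_eq [SFinite μ] (hg : Integrable g μ) (hm : Measurable m)
    (hφ : ∀ x, φ x = ∫ ω, g ω * planeWave x (m ω) ∂μ) (hφi : Integrable φ) (x : ℝ) {ε : ℝ}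
    (hε : 0 < ε) :
    ∫ y in {y : ℝ | ε < |x - y|}, φ y / ((x - y : ℝ) : ℂ) =
      ∫ ω, g ω * planeWave x (m ω) * (-2 * Complex.I *
        ((Real.pi / 2 * (2 * Real.pi * m ω).sign - sinIntegral (2 * Real.pi * m ω * ε) : ℝ) : ℂ))
        ∂μ := by
  obtain ⟨C, hC⟩ := exists_abs_sinIntegral_le
  have hunion : (⋃ n : ℕ, annulus x ε n) = {y : ℝ | ε < |x - y|} := by
    ext y
    simp only [annulus, Set.mem_iUnion, Set.mem_ofPred_eq]
    refine ⟨fun ⟨_, h⟩ => h.1, fun h => ?_⟩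
    obtain ⟨n, hn⟩ := exists_nat_ge |x - y|
    exact ⟨n, h, hn⟩
  have hleft : Tendsto (fun n : ℕ => ∫ y in annulus x ε n, φ y / ((x - y : ℝ) : ℂ)) atTop
      (𝓝 (∫ y in {y : ℝ | ε < |x - y|}, φ y / ((x - y : ℝ) : ℂ))) := by
    rw [← hunion]
    refine tendsto_setIntegral_of_monotone (fun n => measurableSet_annulus _ _ _) ?_ ?_
    · exact fun i j hij y hy => ⟨hy.1, hy.2.trans (by exact_mod_cast hij)⟩
    · rw [hunion]
      exact integrableOn_div_sub hφi x hε
  have hright : Tendsto (fun n : ℕ => ∫ ω, g ω * planeWave x (m ω) * (-2 * Complex.I *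
        ((sinIntegral (2 * Real.pi * m ω * n) - sinIntegral (2 * Real.pi * m ω * ε) : ℝ) : ℂ))
        ∂μ) atTop (𝓝 (∫ ω, g ω * planeWave x (m ω) * (-2 * Complex.I *
        ((Real.pi / 2 * (2 * Real.pi * m ω).sign - sinIntegral (2 * Real.pi * m ω * ε) : ℝ) : ℂ))
        ∂μ)) := by
    refine tendsto_integral_filter_of_dominated_convergence (fun ω => ‖g ω‖ * (2 * (C + C)))
      ?_ ?_ (hg.norm.mul_const _) ?_
    · refine Eventually.of_forall fun n => (integrable_mul_planeWave hg hm x).aestronglyMeasurable.mul ?_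
      have := continuous_sinIntegral.measurable
      exact Measurable.aestronglyMeasurable (by fun_prop)
    · refine Eventually.of_forall fun n => Eventually.of_forall fun ω => ?_
      rw [norm_mul, norm_mul, norm_planeWave, mul_one, norm_mul, Complex.norm_real,
        Real.norm_eq_abs]
      simp only [norm_mul, norm_neg, Complex.norm_I, mul_one, Complex.norm_ofNat]
      gcongr
      exact (abs_sub _ _).trans (add_le_add (hC _) (hC _))
    · refine Eventually.of_forall fun ω => ?_
      refine Tendsto.const_mul _ (Tendsto.const_mul _ ?_)
      refine (Complex.continuous_ofReal.tendsto _).comp ?_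
      exact ((tendsto_sinIntegral_mul _).comp tendsto_natCast_atTop_atTop).sub_const _
  refine tendsto_nhds_unique hleft (hright.congr' ?_)
  filter_upwards [eventually_ge_atTop ⌈ε⌉₊] with n hn
  exact (setIntegral_annulus_div hg hm hφ x hε (Nat.ceil_le.1 hn)).symm

theorem Real.measurable_sign : Measurable Real.sign := by
  unfold Real.sign
  exact Measurable.ite measurableSet_Iio measurable_const
    (Measurable.ite measurableSet_Ioi measurable_const measurable_const)

theorem Real.norm_sign_le_one (r : ℝ) : ‖r.sign‖ ≤ 1 := by
  rcases r.sign_apply_eq with h | h | h <;> simp [h]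

/-- The principal-value Hilbert transform is the Fourier multiplier `-i sgn ξ`. -/
theorem hasPVH_integral [SFinite μ] (hg : Integrable g μ) (hm : Measurable m)
    (hφ : ∀ x, φ x = ∫ ω, g ω * planeWave x (m ω) ∂μ) (hφi : Integrable φ) (x : ℝ) :
    HasPVH φ x (∫ ω, g ω * (-Complex.I * (m ω).sign) * planeWave x (m ω) ∂μ) := by
  obtain ⟨C, hC⟩ := exists_abs_sinIntegral_le
  have hsign : ∀ r : ℝ, (2 * Real.pi * r).sign = r.sign := fun r => by
    have h2 : (0 : ℝ) < 2 * Real.pi := by positivity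
    rcases lt_trichotomy r 0 with h | rfl | h
    · rw [Real.sign_of_neg h, Real.sign_of_neg (by nlinarith)]
    · simp
    · rw [Real.sign_of_pos h, Real.sign_of_pos (by positivity)]
  have hlim : Tendsto (fun ε : ℝ => ∫ ω, g ω * planeWave x (m ω) * (-2 * Complex.I *
        ((Real.pi / 2 * (2 * Real.pi * m ω).sign - sinIntegral (2 * Real.pi * m ω * ε) : ℝ) : ℂ))
        ∂μ) (𝓝[>] 0) (𝓝 (∫ ω, g ω * planeWave x (m ω) * (-2 * Complex.I *
        ((Real.pi / 2 * (2 * Real.pi * m ω).sign - 0 : ℝ) : ℂ)) ∂μ)) := by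
    refine tendsto_integral_filter_of_dominated_convergence
      (fun ω => ‖g ω‖ * (2 * (Real.pi / 2 * 1 + C))) ?_ ?_ (hg.norm.mul_const _) ?_
    · refine Eventually.of_forall fun ε => (integrable_mul_planeWave hg hm x).aestronglyMeasurable.mul ?_
      have := continuous_sinIntegral.measurable
      have := Real.measurable_sign
      exact Measurable.aestronglyMeasurable (by fun_prop)
    · refine Eventually.of_forall fun ε => Eventually.of_forall fun ω => ?_
      rw [norm_mul, norm_mul, norm_planeWave, mul_one, norm_mul, Complex.norm_real,
        Real.norm_eq_abs]
      simp only [norm_mul, norm_neg, Complex.norm_I, mul_one, Complex.norm_ofNat]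
      gcongr
      refine (abs_sub _ _).trans (add_le_add ?_ (hC _))
      rw [abs_mul, abs_of_pos (by positivity)]
      have := Real.norm_sign_le_one (2 * Real.pi * m ω)
      rw [Real.norm_eq_abs] at this
      nlinarith [Real.pi_pos]
    · refine Eventually.of_forall fun ω => ?_
      refine Tendsto.const_mul _ (Tendsto.const_mul _ ?_)
      refine (Complex.continuous_ofReal.tendsto _).comp (Tendsto.const_sub _ ?_)
      have : Continuous fun ε : ℝ => sinIntegral (2 * Real.pi * m ω * ε) :=
        continuous_sinIntegral.comp (by fun_prop)
      simpa [sinIntegral_zero] using (this.tendsto 0).mono_left nhdsWithin_le_nhds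
  have heq : ∫ ω, g ω * (-Complex.I * (m ω).sign) * planeWave x (m ω) ∂μ =
      (Real.pi : ℂ)⁻¹ * ∫ ω, g ω * planeWave x (m ω) * (-2 * Complex.I *
        ((Real.pi / 2 * (2 * Real.pi * m ω).sign - 0 : ℝ) : ℂ)) ∂μ := by
    rw [← integral_const_mul]
    congr 1
    ext ω
    have : (Real.pi : ℂ) ≠ 0 := by simp [Real.pi_ne_zero]
    rw [hsign]
    push_cast
    field_simp
    ring
  rw [HasPVH, heq]
  refine (hlim.const_mul _).congr' ?_
  filter_upwards [self_mem_nhdsWithin] with ε hε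
  rw [setIntegral_div_eq hg hm hφ hφi x hε]

theorem hasDerivAt_integral_planeWave (hg : Integrable g μ) (hm : Measurable m)
    (hgm : Integrable (fun ω => g ω * m ω) μ) (x : ℝ) :
    HasDerivAt (fun x => ∫ ω, g ω * planeWave x (m ω) ∂μ)
      (∫ ω, g ω * (2 * Real.pi * Complex.I * m ω) * planeWave x (m ω) ∂μ) x := by
  have hgm' : Integrable (fun ω => g ω * (2 * Real.pi * Complex.I * m ω)) μ := by
    refine (hgm.const_mul (2 * Real.pi * Complex.I)).congr (Eventually.of_forall fun ω => ?_)
    simp only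
    ring
  refine (hasDerivAt_integral_of_dominated_loc_of_deriv_le (s := Set.univ) (x₀ := x)
    (F := fun x ω => g ω * planeWave x (m ω))
    (F' := fun x ω => g ω * (2 * Real.pi * Complex.I * m ω) * planeWave x (m ω))
    (bound := fun ω => ‖g ω * (2 * Real.pi * Complex.I * m ω)‖) univ_mem
    (Eventually.of_forall fun y => (integrable_mul_planeWave hg hm y).aestronglyMeasurable)
    (integrable_mul_planeWave hg hm x)
    (integrable_mul_planeWave hgm' hm x).aestronglyMeasurable
    (Eventually.of_forall fun ω y _ => ?_) hgm'.norm
    (Eventually.of_forall fun ω y _ => ?_)).2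
  · rw [norm_mul _ (planeWave _ _), norm_planeWave, mul_one]
  · have h1 : HasDerivAt (fun y : ℝ => ((2 * Real.pi * (m ω * y) : ℝ) : ℂ) * Complex.I)
        (((2 * Real.pi * (m ω * 1) : ℝ) : ℂ) * Complex.I) y :=
      ((((hasDerivAt_id y).const_mul (m ω)).const_mul (2 * Real.pi)).ofReal_comp).mul_const _
    refine (h1.cexp.const_mul (g ω)).congr_deriv ?_
    rw [planeWave]
    push_cast
    ring

end FourierMultiplier

section Schwartz

open FourierTransform

variable (f : SchwartzMap ℝ ℂ)

theorem SchwartzMap.eq_integral_planeWave (x : ℝ) : f x = ∫ ξ, 𝓕 f ξ * planeWave x ξ := by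
  have h : f x = 𝓕⁻ (𝓕 f) x := by rw [fourierInv_fourier_eq]
  rw [h, SchwartzMap.fourierInv_coe, Real.fourierInv_eq']
  congr 1
  ext ξ
  rw [smul_eq_mul, mul_comm, planeWave, real_inner_eq_re_inner]
  simp [mul_comm]

theorem SchwartzMap.integrable_mul_ofReal : Integrable fun x => f x * (x : ℂ) := by
  have h := f.integrable_pow_mul volume 1
  refine (h.congr (Eventually.of_forall fun x => ?_)).mono'
    (f.continuous.mul Complex.continuous_ofReal).aestronglyMeasurable
    (Eventually.of_forall fun x => le_rfl)
  simp [mul_comm]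

theorem integrable_mul_sign {g : ℝ → ℂ} (hg : Integrable g) :
    Integrable fun ξ : ℝ => g ξ * (-Complex.I * ξ.sign) := by
  have := Real.measurable_sign
  refine hg.mul_bdd (c := 1) (Measurable.aestronglyMeasurable (by fun_prop))
    (Eventually.of_forall fun ξ => ?_)
  simpa using Real.norm_sign_le_one ξ

theorem SchwartzMap.hasPVH (x : ℝ) :
    HasPVH f x (∫ ξ, 𝓕 f ξ * (-Complex.I * ξ.sign) * planeWave x ξ) :=
  hasPVH_integral (𝓕 f).integrable measurable_id f.eq_integral_planeWave f.integrable x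

theorem SchwartzMap.pvH_eq (x : ℝ) :
    pvH f x = ∫ ξ, 𝓕 f ξ * (-Complex.I * ξ.sign) * planeWave x ξ :=
  (f.hasPVH x).pvH_eq

theorem SchwartzMap.hasPVH_deriv (x : ℝ) : HasPVH (deriv f) x (pvH (deriv f) x) := by
  have h := (SchwartzMap.derivCLM ℝ ℂ f).hasPVH x
  have h' : ⇑(SchwartzMap.derivCLM ℝ ℂ f) = deriv f := by
    ext y
    exact SchwartzMap.derivCLM_apply ℝ f y
  rw [h'] at h
  rwa [h.pvH_eq]

theorem SchwartzMap.integrable_deriv : Integrable (deriv f) :=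
  (SchwartzMap.derivCLM ℝ ℂ f).integrable

/-- The Hilbert transform commutes with differentiation. -/
theorem SchwartzMap.hasDerivAt_pvH (x : ℝ) : HasDerivAt (pvH f) (pvH (deriv f) x) x := by
  have hfun : pvH f = fun x => ∫ ξ, 𝓕 f ξ * (-Complex.I * ξ.sign) * planeWave x ξ :=
    funext f.pvH_eq
  have hderiv : ∀ y, deriv f y =
      ∫ ξ : ℝ, 𝓕 f ξ * (2 * Real.pi * Complex.I * ξ) * planeWave y ξ := by
    intro y
    have h := hasDerivAt_integral_planeWave (𝓕 f).integrable measurable_id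
      (𝓕 f).integrable_mul_ofReal y
    refine HasDerivAt.deriv (h.congr_of_eventuallyEq ?_)
    exact Eventually.of_forall f.eq_integral_planeWave
  have hgm : Integrable fun ξ : ℝ => 𝓕 f ξ * (2 * Real.pi * Complex.I * ξ) := by
    refine ((𝓕 f).integrable_mul_ofReal.const_mul (2 * Real.pi * Complex.I)).congr
      (Eventually.of_forall fun ω => ?_)
    simp only
    ring
  have hgs : Integrable fun ξ : ℝ => 𝓕 f ξ * (-Complex.I * ξ.sign) * (ξ : ℂ) :=
    (integrable_mul_sign (𝓕 f).integrable_mul_ofReal).congr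
      (Eventually.of_forall fun ω => by simp only; ring)
  rw [(hasPVH_integral hgm measurable_id hderiv f.integrable_deriv x).pvH_eq, hfun]
  refine (hasDerivAt_integral_planeWave (integrable_mul_sign (𝓕 f).integrable) measurable_id
    hgs x).congr_deriv ?_
  congr 1
  ext ξ
  simp only [id]
  ring

theorem SchwartzMap.norm_pvH_le (x : ℝ) : ‖pvH f x‖ ≤ ∫ ξ, ‖𝓕 f ξ * (-Complex.I * ξ.sign)‖ := by
  rw [f.pvH_eq]
  refine (norm_integral_le_integral_norm _).trans_eq ?_
  congr 1
  ext ξ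
  rw [norm_mul _ (planeWave _ _), norm_planeWave, mul_one]

theorem SchwartzMap.integrable_pvH_mul : Integrable fun x => pvH f x * f x :=
  f.integrable.bdd_mul (continuous_iff_continuousAt.2
    fun x => (f.hasDerivAt_pvH x).continuousAt).aestronglyMeasurable
    (Eventually.of_forall f.norm_pvH_le)

theorem Real.sign_add_mul_sign_add_sign {a : ℝ} (ha : a ≠ 0) (b : ℝ) :
    (a + b).sign * (a.sign + b.sign) = 1 + a.sign * b.sign := by
  rcases lt_or_gt_of_ne ha with h | h <;> rcases lt_trichotomy b 0 with h' | rfl | h'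
  · rw [Real.sign_of_neg h, Real.sign_of_neg h', Real.sign_of_neg (by linarith)]; norm_num
  · simp [Real.sign_of_neg h]
  · rw [Real.sign_of_neg h, Real.sign_of_pos h']; norm_num
  · rw [Real.sign_of_pos h, Real.sign_of_neg h']; norm_num
  · simp [Real.sign_of_pos h]
  · rw [Real.sign_of_pos h, Real.sign_of_pos h', Real.sign_of_pos (by linarith)]; norm_num

/-- Tricomi's identity `2 H(f Hf) = (Hf)² - f²`. -/
theorem SchwartzMap.hasPVH_pvH_mul (x : ℝ) :
    HasPVH (fun y => pvH f y * f y) x (1 / 2 * (pvH f x ^ 2 - f x ^ 2)) := by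
  set g : ℝ → ℂ := ⇑(𝓕 f : SchwartzMap ℝ ℂ)
  set k : ℝ → ℂ := fun ξ => g ξ * (-Complex.I * ξ.sign) with hk_def
  have hg : Integrable g := (𝓕 f).integrable
  have hk : Integrable k := integrable_mul_sign hg
  have hm : Measurable fun p : ℝ × ℝ => p.1 + p.2 := by fun_prop
  have prod : ∀ (a b : ℝ → ℂ) (y : ℝ), (∫ ξ, a ξ * planeWave y ξ) * (∫ ξ, b ξ * planeWave y ξ) =
      ∫ p : ℝ × ℝ, a p.1 * b p.2 * planeWave y (p.1 + p.2) := by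
    intro a b y
    rw [← integral_prod_mul]
    congr 1
    ext p
    rw [planeWave_add_right]
    ring
  have hlim := hasPVH_integral (hk.mul_prod hg) hm
    (fun y => by rw [f.pvH_eq y, f.eq_integral_planeWave y]; exact prod k g y)
    f.integrable_pvH_mul x
  convert hlim using 1
  set J : ℝ × ℝ → ℂ := fun p =>
    k p.1 * g p.2 * (-Complex.I * (p.1 + p.2).sign) * planeWave x (p.1 + p.2) with hJ_def
  have hJ : Integrable J := by
    have := Real.measurable_sign
    refine integrable_mul_planeWave ((hk.mul_prod hg).mul_bdd (c := 1)
      (Measurable.aestronglyMeasurable (by fun_prop)) (Eventually.of_forall fun p => ?_)) hm x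
    simpa using Real.norm_sign_le_one (p.1 + p.2)
  have hswap : ∫ p : ℝ × ℝ, J p.swap = ∫ p, J p := integral_prod_swap J
  have hsq : pvH f x ^ 2 - f x ^ 2 = ∫ p, J p + J p.swap := by
    have hH2 : pvH f x ^ 2 = ∫ p : ℝ × ℝ, k p.1 * k p.2 * planeWave x (p.1 + p.2) := by
      rw [pow_two, f.pvH_eq x]
      exact prod k k x
    have hf2 : f x ^ 2 = ∫ p : ℝ × ℝ, g p.1 * g p.2 * planeWave x (p.1 + p.2) := by
      rw [pow_two, f.eq_integral_planeWave x]
      exact prod g g x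
    rw [hH2, hf2, Measure.volume_eq_prod,
      ← integral_sub (integrable_mul_planeWave (hk.mul_prod hk) hm x)
        (integrable_mul_planeWave (hg.mul_prod hg) hm x)]
    have hne : ∀ᵐ p : ℝ × ℝ, p.1 ≠ 0 :=
      Measure.quasiMeasurePreserving_fst.ae (Measure.ae_ne volume (0 : ℝ))
    refine integral_congr_ae ?_
    filter_upwards [hne] with p hp
    have hs := congrArg (Complex.ofReal) (Real.sign_add_mul_sign_add_sign hp p.2)
    push_cast at hs
    simp only [hJ_def, hk_def, Prod.fst_swap, Prod.snd_swap, add_comm p.2 p.1]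
    linear_combination (-Complex.I ^ 2 * g p.1 * g p.2 * planeWave x (p.1 + p.2)) * hs -
      g p.1 * g p.2 * planeWave x (p.1 + p.2) * Complex.I_sq
  have hJs : Integrable fun p : ℝ × ℝ => J p.swap := hJ.swap
  rw [hsq, integral_add hJ hJs, hswap, ← Measure.volume_eq_prod]
  ring

theorem SchwartzMap.exists_eq_vsq (v : SchwartzMap ℝ ℂ) :
    ∃ f : SchwartzMap ℝ ℂ, ⇑f = vsq v := by
  refine ⟨SchwartzMap.pairing (ContinuousLinearMap.mul ℝ ℂ) v
    (SchwartzMap.postcompCLM (𝕜 := ℝ) (Complex.conjCLE : ℂ →L[ℝ] ℂ) v), ?_⟩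
  ext y
  simp [SchwartzMap.pairing_apply_apply, vsq, Complex.mul_conj, Complex.normSq_eq_norm_sq]

theorem SchwartzMap.deriv_vsq (v : SchwartzMap ℝ ℂ) (y : ℝ) :
    deriv (vsq v) y = ((2 * ((starRingEnd ℂ) (v y) * deriv v y).re : ℝ) : ℂ) := by
  have hfun : vsq v = fun y => v y * (starRingEnd ℂ) (v y) := by
    ext y
    simp [vsq, Complex.mul_conj, Complex.normSq_eq_norm_sq]
  have hv : HasDerivAt v (deriv v y) y := v.differentiableAt.hasDerivAt
  rw [hfun]
  refine (hv.mul hv.star).deriv.trans ?_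
  apply Complex.ext <;> simp <;> ring

end Schwartz

/-- Self-dual form of the gauged Calogero–Moser DNLS: with `w = 𝐃_v v`,
`L_v* w = −∂ₓₓ v − |D|(|v|²) v + ¼|v|⁴ v` pointwise; in particular
`¼(H(|v|²))² v − ½ H(H(|v|²)·|v|²) v = ¼ |v|⁴ v` pointwise. -/
theorem stmt5 (v : SchwartzMap ℝ ℂ) :
    (∀ x : ℝ,
        -deriv (Bog (fun y => v y)) x
            + (1 / 2) * pvH (vsq (fun y => v y)) x * Bog (fun y => v y) x
            - v x * pvH (fun y =>
                ((((starRingEnd ℂ) (v y) * Bog (fun z => v z) y).re : ℝ) : ℂ)) x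
          = -deriv (deriv (fun y => v y)) x - absD (vsq (fun y => v y)) x * v x
              + (1 / 4) * ((‖v x‖ ^ 4 : ℝ) : ℂ) * v x) ∧
      ∀ x : ℝ,
        (1 / 4) * (pvH (vsq (fun y => v y)) x) ^ 2 * v x
            - (1 / 2) * pvH (fun y =>
                pvH (vsq (fun z => v z)) y * vsq (fun z => v z) y) x * v x
          = (1 / 4) * ((‖v x‖ ^ 4 : ℝ) : ℂ) * v x := by
  obtain ⟨f, hf⟩ := v.exists_eq_vsq
  have hsq : ∀ x, f x ^ 2 = ((‖v x‖ ^ 4 : ℝ) : ℂ) := fun x => by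
    rw [hf, vsq]
    push_cast
    ring
  have hfreal : ∀ x, (starRingEnd ℂ) (f x) = f x := fun x => by
    rw [hf, vsq, Complex.conj_ofReal]
  have hHreal : ∀ x, (starRingEnd ℂ) (pvH f x) = pvH f x := fun x => by
    rw [f.pvH_eq]
    exact (f.hasPVH x).conj_eq hfreal
  rw [← hf]
  constructor
  · intro x
    have hBog : Bog v = fun y => deriv v y + (1 / 2) * pvH f y * v y := by
      rw [hf]
      rfl
    have hv : HasDerivAt v (deriv v x) x := v.differentiableAt.hasDerivAt
    have hv' : HasDerivAt (deriv v) (deriv (deriv v) x) x :=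
      (SchwartzMap.derivCLM ℝ ℂ v).differentiableAt.hasDerivAt
    have hBog' : deriv (Bog v) x = deriv (deriv v) x +
        (1 / 2 * pvH (deriv f) x * v x + 1 / 2 * pvH f x * deriv v x) := by
      rw [hBog]
      exact (hv'.add (((f.hasDerivAt_pvH x).const_mul (1 / 2)).mul hv)).deriv
    have hre : (fun y => ((((starRingEnd ℂ) (v y) * Bog v y).re : ℝ) : ℂ)) =
        fun y => 1 / 2 * (deriv f y + pvH f y * f y) := by
      ext y
      obtain ⟨r, hr⟩ := Complex.conj_eq_iff_real.1 (hHreal y)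
      have hn : (starRingEnd ℂ) (v y) * v y = ((‖v y‖ ^ 2 : ℝ) : ℂ) := by
        rw [mul_comm, Complex.mul_conj, Complex.normSq_eq_norm_sq]
      have hexp : (starRingEnd ℂ) (v y) * Bog v y =
          (starRingEnd ℂ) (v y) * deriv v y + ((1 / 2 * r * ‖v y‖ ^ 2 : ℝ) : ℂ) := by
        rw [hBog]
        simp only [hr]
        push_cast at hn ⊢
        linear_combination (1 / 2 * (r : ℂ)) * hn
      rw [hexp, Complex.add_re, Complex.ofReal_re, hr, hf, v.deriv_vsq, vsq]
      push_cast
      ring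
    rw [hre, ((f.hasPVH_deriv x).const_mul_add (f.hasPVH_pvH_mul x) f.integrable_deriv
      f.integrable_pvH_mul (1 / 2)).pvH_eq, hBog', hBog, hsq, absD]
    ring
  · intro x
    rw [(f.hasPVH_pvH_mul x).pvH_eq, hsq]
    ring
end

section
/- Let Q(x) := √2/(1+x²)^{1/2}. Then: (i) H(Q²)(x) = x·Q²(x) for every x ∈ ℝ, i.e. the Hilbert transform of y ↦ 2/(1+y²) is x ↦ 2x/(1+x²); (ii) consequently ∂ₓQ + ½·H(Q²)·Q = 0 on ℝ, i.e. Q solves the Bogomol'nyi equation 𝐃_Q Q = 0; (iii) ∫_ℝ Q(x)² dx = 2π and the self-dual energy E(Q) = ½·∫_ℝ |∂ₓQ + ½·H(Q²)·Q|² dx = 0. -/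
open MeasureTheory Filter Topology

/-- The soliton `Q(x) = √2/√(1+x²)` (real-valued). -/
noncomputable def Qr (x : ℝ) : ℝ := Real.sqrt 2 / Real.sqrt (1 + x ^ 2)

/-- The soliton, viewed as a complex-valued function. -/
noncomputable def Qc (x : ℝ) : ℂ := (Qr x : ℂ)

lemma Qr_sq (x : ℝ) : Qr x ^ 2 = 2 / (1 + x ^ 2) := by
  rw [Qr, div_pow, Real.sq_sqrt (by norm_num), Real.sq_sqrt (by positivity)]

lemma hasDerivAt_Qr (x : ℝ) : HasDerivAt Qr (-(x / (1 + x ^ 2)) * Qr x) x := by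
  have hpos : 0 < 1 + x ^ 2 := by positivity
  have hs : Real.sqrt (1 + x ^ 2) ≠ 0 := (Real.sqrt_pos.2 hpos).ne'
  have h1 : HasDerivAt (fun y : ℝ => 1 + y ^ 2) (2 * x) x := by
    simpa using (hasDerivAt_pow 2 x).const_add 1
  refine HasDerivAt.congr_deriv (f := Qr)
    ((hasDerivAt_const x (Real.sqrt 2)).div (h1.sqrt hpos.ne') hs) ?_
  rw [Qr, Real.sq_sqrt hpos.le]
  have h2 := Real.sq_sqrt hpos.le
  field_simp
  ring

/-- A primitive of `y ↦ 2 / (1 + y²) / (x - y)` away from `x`. -/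
noncomputable def cauchyPrimitive (x y : ℝ) : ℝ :=
  2 / (1 + x ^ 2) * (x * Real.arctan y - 1 / 2 * Real.log ((x - y) ^ 2 / (1 + y ^ 2)))

lemma hasDerivAt_cauchyPrimitive {x y : ℝ} (h : x - y ≠ 0) :
    HasDerivAt (cauchyPrimitive x) (2 / (1 + y ^ 2) / (x - y)) y := by
  have hx : 1 + x ^ 2 ≠ 0 := by positivity
  have hy : 1 + y ^ 2 ≠ 0 := by positivity
  have h1 : HasDerivAt (fun y : ℝ => 1 + y ^ 2) (2 * y) y := by
    simpa using (hasDerivAt_pow 2 y).const_add 1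
  have h2 : HasDerivAt (fun y : ℝ => (x - y) ^ 2) (-(2 * (x - y))) y := by
    simpa using ((hasDerivAt_id' y).const_sub x).fun_pow 2
  have h3 := (h2.fun_div h1 hy).log (div_ne_zero (pow_ne_zero 2 h) hy)
  refine HasDerivAt.congr_deriv (f := cauchyPrimitive x)
    ((((Real.hasDerivAt_arctan y).const_mul x).sub (h3.const_mul (1 / 2))).const_mul
      (2 / (1 + x ^ 2))) ?_
  field_simp
  ring

lemma tendsto_sq_sub_div_one_add_sq (x : ℝ) {l : Filter ℝ}
    (hl : Tendsto (fun y : ℝ => y⁻¹) l (𝓝 0)) (h0 : ∀ᶠ y in l, y ≠ 0) :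
    Tendsto (fun y : ℝ => (x - y) ^ 2 / (1 + y ^ 2)) l (𝓝 1) := by
  have h1 : Tendsto (fun y : ℝ => (x * y⁻¹ - 1) ^ 2 / ((y⁻¹) ^ 2 + 1)) l
      (𝓝 ((x * 0 - 1) ^ 2 / (0 ^ 2 + 1))) :=
    (((hl.const_mul x).sub_const 1).pow 2).div ((hl.pow 2).add_const 1) (by norm_num)
  norm_num at h1
  refine h1.congr' ?_
  filter_upwards [h0] with y hy
  have hy' : 1 + y ^ 2 ≠ 0 := by positivity
  field_simp

lemma tendsto_cauchyPrimitive (x : ℝ) {l : Filter ℝ} {a : ℝ}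
    (hl : Tendsto (fun y : ℝ => y⁻¹) l (𝓝 0)) (h0 : ∀ᶠ y in l, y ≠ 0)
    (ha : Tendsto Real.arctan l (𝓝 a)) :
    Tendsto (cauchyPrimitive x) l (𝓝 (2 / (1 + x ^ 2) * (x * a))) := by
  have h1 := (tendsto_sq_sub_div_one_add_sq x hl h0).log one_ne_zero
  rw [Real.log_one] at h1
  have h2 := ((ha.const_mul x).sub (h1.const_mul (1 / 2))).const_mul (2 / (1 + x ^ 2))
  rw [mul_zero, sub_zero] at h2
  exact h2

lemma integrableOn_cauchy_kernel (x : ℝ) {ε : ℝ} (hε : 0 < ε) :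
    IntegrableOn (fun y : ℝ => 2 / (1 + y ^ 2) / (x - y)) {y | ε < |x - y|} := by
  have hm : MeasurableSet {y : ℝ | ε < |x - y|} :=
    measurableSet_lt measurable_const (by fun_prop)
  have hi : Integrable (fun y : ℝ => 2 / ε * (1 + y ^ 2)⁻¹) :=
    integrable_inv_one_add_sq.const_mul _
  refine hi.integrableOn.mono' (Measurable.aestronglyMeasurable (by fun_prop)) ?_
  refine (ae_restrict_iff' hm).2 (Eventually.of_forall fun y hy => ?_)
  have hy : ε < |x - y| := hy
  have hp : 0 < 1 + y ^ 2 := by positivity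
  rw [Real.norm_eq_abs, abs_div, abs_of_pos (by positivity : 0 < 2 / (1 + y ^ 2))]
  calc 2 / (1 + y ^ 2) / |x - y| ≤ 2 / (1 + y ^ 2) / ε := by gcongr
    _ = 2 / ε * (1 + y ^ 2)⁻¹ := by field_simp

lemma setOf_lt_abs_sub (x : ℝ) (ε : ℝ) :
    {y : ℝ | ε < |x - y|} = Set.Iio (x - ε) ∪ Set.Ioi (x + ε) := by
  ext y
  simp only [Set.mem_ofPred_eq, Set.mem_union, Set.mem_Iio, Set.mem_Ioi, lt_abs]
  constructor <;> rintro (h | h)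
  · left; linarith
  · right; linarith
  · left; linarith
  · right; linarith

lemma integral_cauchy_kernel (x : ℝ) {ε : ℝ} (hε : 0 < ε) :
    ∫ y in {y : ℝ | ε < |x - y|}, 2 / (1 + y ^ 2) / (x - y) =
      2 / (1 + x ^ 2) * (x * Real.pi) +
        (cauchyPrimitive x (x - ε) - cauchyPrimitive x (x + ε)) := by
  have hi := integrableOn_cauchy_kernel x hε
  rw [setOf_lt_abs_sub] at hi ⊢
  have hd : Disjoint (Set.Iio (x - ε)) (Set.Ioi (x + ε)) :=
    Set.disjoint_left.2 fun y h1 h2 => by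
      rw [Set.mem_Iio] at h1
      rw [Set.mem_Ioi] at h2
      linarith
  have hl : IntegrableOn (fun y : ℝ => 2 / (1 + y ^ 2) / (x - y)) (Set.Iic (x - ε)) :=
    (integrableOn_Iic_iff_integrableOn_Iio (by simp)).2 hi.left_of_union
  rw [setIntegral_union hd measurableSet_Ioi hi.left_of_union hi.right_of_union,
    ← integral_Iic_eq_integral_Iio,
    integral_Iic_of_hasDerivAt_of_tendsto' (f := cauchyPrimitive x)
      (fun y hy => hasDerivAt_cauchyPrimitive (by rw [Set.mem_Iic] at hy; linarith)) hl
      (tendsto_cauchyPrimitive x tendsto_inv_atBot_zero (eventually_ne_atBot 0)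
        (Real.tendsto_arctan_atBot.mono_right nhdsWithin_le_nhds)),
    integral_Ioi_of_hasDerivAt_of_tendsto' (f := cauchyPrimitive x)
      (fun y hy => hasDerivAt_cauchyPrimitive (by rw [Set.mem_Ici] at hy; linarith))
      hi.right_of_union
      (tendsto_cauchyPrimitive x tendsto_inv_atTop_zero (eventually_ne_atTop 0)
        (Real.tendsto_arctan_atTop.mono_right nhdsWithin_le_nhds))]
  ring

lemma tendsto_cauchyPrimitive_sub (x : ℝ) :
    Tendsto (fun ε : ℝ => cauchyPrimitive x (x - ε) - cauchyPrimitive x (x + ε))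
      (𝓝[>] 0) (𝓝 0) := by
  have hc : Continuous fun ε : ℝ => 2 / (1 + x ^ 2) *
      (x * (Real.arctan (x - ε) - Real.arctan (x + ε)) +
        1 / 2 * (Real.log (1 + (x - ε) ^ 2) - Real.log (1 + (x + ε) ^ 2))) := by
    have h1 : ∀ ε : ℝ, 1 + (x - ε) ^ 2 ≠ 0 := fun ε => by positivity
    have h2 : ∀ ε : ℝ, 1 + (x + ε) ^ 2 ≠ 0 := fun ε => by positivity
    fun_prop (disch := assumption)
  have ht := (hc.tendsto 0).mono_left (nhdsWithin_le_nhds (s := Set.Ioi 0))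
  simp only [sub_zero, add_zero, sub_self, mul_zero] at ht
  refine ht.congr' ?_
  filter_upwards [self_mem_nhdsWithin] with ε hε
  have hε : ε ≠ 0 := (Set.mem_Ioi.1 hε).ne'
  have h1 : x - (x - ε) = ε := by ring
  have h2 : x - (x + ε) = -ε := by ring
  rw [cauchyPrimitive, cauchyPrimitive, h1, h2, neg_sq,
    Real.log_div (pow_ne_zero 2 hε) (by positivity),
    Real.log_div (pow_ne_zero 2 hε) (by positivity)]
  ring

lemma pvH_Qc_sq (x : ℝ) : pvH (fun y => Qc y ^ 2) x = (x : ℂ) * Qc x ^ 2 := by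
  refine Tendsto.limUnder_eq ?_
  have hr : Tendsto (fun ε : ℝ => Real.pi⁻¹ * (2 / (1 + x ^ 2) * (x * Real.pi) +
      (cauchyPrimitive x (x - ε) - cauchyPrimitive x (x + ε)))) (𝓝[>] 0)
      (𝓝 (x * Qr x ^ 2)) := by
    have h := ((tendsto_cauchyPrimitive_sub x).const_add
      (2 / (1 + x ^ 2) * (x * Real.pi))).const_mul Real.pi⁻¹
    convert h using 2
    rw [Qr_sq]
    field_simp [Real.pi_ne_zero]
    ring
  have hc := (Complex.continuous_ofReal.tendsto _).comp hr
  have hx : ((x * Qr x ^ 2 : ℝ) : ℂ) = (x : ℂ) * Qc x ^ 2 := by simp [Qc]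
  rw [hx] at hc
  refine hc.congr' ?_
  filter_upwards [self_mem_nhdsWithin] with ε hε
  rw [Function.comp_apply, ← integral_cauchy_kernel x hε, Complex.ofReal_mul,
    Complex.ofReal_inv, ← integral_complex_ofReal]
  congr 2
  ext y
  rw [← Qr_sq, Qc]
  push_cast
  rfl

lemma deriv_Qc_add (x : ℝ) :
    deriv Qc x + (1 / 2) * pvH (fun y => Qc y ^ 2) x * Qc x = 0 := by
  have hd : HasDerivAt Qc ((-(x / (1 + x ^ 2)) * Qr x : ℝ) : ℂ) x :=
    (hasDerivAt_Qr x).ofReal_comp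
  have h2 : Qc x ^ 2 = ((2 / (1 + x ^ 2) : ℝ) : ℂ) := by rw [← Qr_sq, Qc]; push_cast; rfl
  rw [hd.deriv, pvH_Qc_sq, h2, Qc]
  push_cast
  ring

/-- Properties of the soliton `Q`: (i) `H(Q²)(x) = x Q²(x)`; (ii) `Q` solves the
Bogomol'nyi equation `∂ₓQ + ½ H(Q²) Q = 0`; (iii) `M(Q) = ∫ Q² = 2π` and the self-dual
energy `E(Q) = ½∫|∂ₓQ + ½H(Q²)Q|² = 0`. -/
theorem stmt6 :
    (∀ x : ℝ, pvH (fun y => Qc y ^ 2) x = (x : ℂ) * Qc x ^ 2) ∧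
      (∀ x : ℝ, deriv Qc x + (1 / 2) * pvH (fun y => Qc y ^ 2) x * Qc x = 0) ∧
      (∫ x : ℝ, Qr x ^ 2) = 2 * Real.pi ∧
      (1 / 2) * (∫ x : ℝ,
          ‖deriv Qc x + (1 / 2) * pvH (fun y => Qc y ^ 2) x * Qc x‖ ^ 2) = 0 := by
  refine ⟨pvH_Qc_sq, deriv_Qc_add, ?_, ?_⟩
  · simp_rw [Qr_sq, div_eq_mul_inv]
    rw [integral_const_mul, integral_univ_inv_one_add_sq]
  · simp only [deriv_Qc_add]
    simp
end
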